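/- arXiv:1204.4547 — 2 statements merged into one kernel-verified Lean document; each statement's English description precedes it below -/
import Mathlib

section
/- Let x ∈ ℝ^n satisfy ∑_{i=1}^n x_i = z_{[n]} and ∑_{i∈R_δ} x_i ≥ w_δ for every proper diagonal δ. Then ∑_{i∈I} x_i ≥ z^c_I for every nonempty I ⊆ [n]. Moreover z^c_{R_δ} = w_δ for every proper diagonal δ, so the two subsets of ℝ^n, {x : ∑_{i=1}^n x_i = z_{[n]} and ∑_{i∈R_δ} x_i ≥ w_δ for all proper diagonals δ} and {x : ∑_{i=1}^n x_i = z_{[n]} and ∑_{i∈I} x_i ≥ z^c_I for all nonempty I ⊆ [n]}, coincide. -/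
open Finset

attribute [local instance] Classical.propDecidable

namespace AssocPaper

/-- `x` and `y` are consecutive elements of the finite set `S`. -/
def ConsecIn (S : Finset ℕ) (x y : ℕ) : Prop :=
  x ∈ S ∧ y ∈ S ∧ x < y ∧ ∀ z ∈ S, ¬ (x < z ∧ z < y)

/-- `D̄ = D ∪ {0, n+1}`. -/
def Dbar (n : ℕ) (D : Finset ℕ) : Finset ℕ := insert 0 (insert (n + 1) D)

/-- The boundary edges of the `c`-labeled `(n+2)`-gon, given by endpoints `x < y`:
pairs of consecutive elements of `D̄`; if `U ≠ ∅` also `{0, min U}`, `{max U, n+1}` and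
pairs of consecutive elements of `U`; if `U = ∅` also `{0, n+1}`. -/
def IsBoundary (n : ℕ) (D U : Finset ℕ) (x y : ℕ) : Prop :=
  ConsecIn (Dbar n D) x y
    ∨ (U.Nonempty ∧
        ((x = 0 ∧ y ∈ U ∧ ∀ u ∈ U, y ≤ u)
          ∨ (y = n + 1 ∧ x ∈ U ∧ ∀ u ∈ U, u ≤ x)
          ∨ ConsecIn U x y))
    ∨ (U = ∅ ∧ x = 0 ∧ y = n + 1)

/-- `{x, y}` (with `x < y ≤ n+1`) is a proper diagonal: a diagonal of the
`(n+2)`-gon which is not a boundary edge. -/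
def IsProper (n : ℕ) (D U : Finset ℕ) (x y : ℕ) : Prop :=
  x < y ∧ y ≤ n + 1 ∧ ¬ IsBoundary n D U x y

/-- The set `R_δ` for a proper diagonal `δ = {x,y}` with `x < y`. -/
noncomputable def Rdiag (n : ℕ) (D U : Finset ℕ) (x y : ℕ) : Finset ℕ :=
  if x ∈ U then
    (if y ∈ U then (D ∪ U.filter fun u => u ≤ x) ∪ U.filter fun u => y ≤ u
     else D.filter (fun d => d < y) ∪ U.filter fun u => u ≤ x)
  else
    (if y ∈ U then D.filter (fun d => x < d) ∪ U.filter fun u => y ≤ u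
     else D.filter fun d => x < d ∧ d < y)

/-- The extension of `R` to non-proper and degenerate diagonals `δ = {x,y}`, `x ≤ y`:
`R_δ = [n]` if `U = ∅` and `δ = {0,n+1}`; for other non-proper or degenerate `δ`,
`R_δ = ∅` if `x,y ∈ D̄` and `R_δ = [n]` otherwise. -/
noncomputable def Rext (n : ℕ) (D U : Finset ℕ) (x y : ℕ) : Finset ℕ :=
  if IsProper n D U x y then Rdiag n D U x y
  else if U = ∅ ∧ x = 0 ∧ y = n + 1 then Finset.Icc 1 n
  else if x ∈ U ∨ y ∈ U then Finset.Icc 1 n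
  else ∅

/-- The extension of the right-hand sides `z_{R_δ}` to non-proper and degenerate
diagonals, given the values `w` on proper diagonals and the value `zn = z_{[n]}`. -/
noncomputable def zext (n : ℕ) (D U : Finset ℕ) (w : ℕ × ℕ → ℝ) (zn : ℝ) (x y : ℕ) : ℝ :=
  if IsProper n D U x y then w (x, y)
  else if U = ∅ ∧ x = 0 ∧ y = n + 1 then zn
  else if x ∈ U ∨ y ∈ U then zn
  else 0

/-- `a(I)`: the largest element of `D ∪ {0}` smaller than `min I`. -/
noncomputable def aI (D I : Finset ℕ) : ℕ :=
  ((insert 0 D).filter fun e => ∀ i ∈ I, e < i).sup id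

/-- `b(I)`: the smallest element of `D ∪ {n+1}` larger than `max I`. -/
noncomputable def bI (n : ℕ) (D I : Finset ℕ) : ℕ :=
  sInf {e : ℕ | e ∈ insert (n + 1) D ∧ ∀ i ∈ I, i < e}

/-- The minimum element `γ` of `I` (junk value for `I = ∅`). -/
noncomputable def minEl (I : Finset ℕ) : ℕ := sInf {i : ℕ | i ∈ I}

/-- The maximum element `Γ` of `I` (junk value `0` for `I = ∅`). -/
noncomputable def maxEl (I : Finset ℕ) : ℕ := I.sup id

/-- A nonempty `I ⊆ [n]` is nested if every `d ∈ D` with `a(I) < d < b(I)` lies in `I`. -/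
def IsNested (n : ℕ) (D I : Finset ℕ) : Prop :=
  I.Nonempty ∧ I ⊆ Finset.Icc 1 n ∧
    ∀ d ∈ D, aI D I < d → d < bI n D I → d ∈ I

/-- The nested components of `I`: the inclusion-maximal nested subsets of `I`. -/
noncomputable def nestedComponents (n : ℕ) (D I : Finset ℕ) : Finset (Finset ℕ) :=
  I.powerset.filter fun J =>
    IsNested n D J ∧ ∀ K ∈ I.powerset, IsNested n D K → J ⊆ K → J = K

/-- `v(I)`: the number of nested components of `I`. -/
noncomputable def vI (n : ℕ) (D I : Finset ℕ) : ℕ := (nestedComponents n D I).card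

/-- `x` is the last element of one of the up intervals of `J`
(an element of `J ∩ U` whose successor in `U`, if any, is not in `J`). -/
def IsRunEnd (U J : Finset ℕ) (x : ℕ) : Prop :=
  x ∈ J ∧ x ∈ U ∧ ∀ y, ConsecIn U x y → y ∉ J

/-- `y` is the first element of one of the up intervals of `J`
(an element of `J ∩ U` whose predecessor in `U`, if any, is not in `J`). -/
def IsRunStart (U J : Finset ℕ) (y : ℕ) : Prop :=
  y ∈ J ∧ y ∈ U ∧ ∀ x, ConsecIn U x y → x ∉ J

/-- `{x,y}` is one of the diagonals `δ_1(J), …, δ_{w+1}(J)` associated to a nested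
set `J` with `a = a(J)`, `b = b(J)` and up intervals `[α_1,β_1]_U, …, [α_w,β_w]_U`,
namely `{a,α_1}, {β_1,α_2}, …, {β_w,b}` (and `{a,b}` when `w = 0`). -/
def AssocDiag (n : ℕ) (D U J : Finset ℕ) (x y : ℕ) : Prop :=
  x < y ∧ (x = aI D J ∨ IsRunEnd U J x) ∧ (y = bI n D J ∨ IsRunStart U J y) ∧
    ∀ u ∈ J ∩ U, ¬ (x < u ∧ u < y)

/-- `W(J)`: the proper diagonals among the diagonals associated to the nested set `J`. -/
noncomputable def WJ (n : ℕ) (D U J : Finset ℕ) : Finset (ℕ × ℕ) :=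
  (Finset.range (n + 2) ×ˢ Finset.range (n + 2)).filter fun p =>
    AssocDiag n D U J p.1 p.2 ∧ IsProper n D U p.1 p.2

/-- The tight value `z^c_I = ∑_i ( ∑_{j ∈ W(J_i)} w_{δ_j(J_i)} − (|W(J_i)|−1)·z_{[n]} )`,
the sum running over the nested components `J_i` of `I` (so `z^c_∅ = 0`). -/
noncomputable def zc (n : ℕ) (D U : Finset ℕ) (w : ℕ × ℕ → ℝ) (zn : ℝ) (I : Finset ℕ) : ℝ :=
  ∑ J ∈ nestedComponents n D I,
    ((∑ p ∈ WJ n D U J, w p) - (((WJ n D U J).card : ℝ) - 1) * zn)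

/-- The Minkowski coefficient `y_I = ∑_{J ⊆ I} (−1)^{|I∖J|} z^c_J`. -/
noncomputable def yI (n : ℕ) (D U : Finset ℕ) (w : ℕ × ℕ → ℝ) (zn : ℝ) (I : Finset ℕ) : ℝ :=
  ∑ J ∈ I.powerset, (-1 : ℝ) ^ (I \ J).card * zc n D U w zn J

/-- The associahedron right-hand sides `w_δ = |R_δ|·(|R_δ|+1)/2`. -/
noncomputable def wAs (n : ℕ) (D U : Finset ℕ) (p : ℕ × ℕ) : ℝ :=
  (((Rdiag n D U p.1 p.2).card : ℝ) * (((Rdiag n D U p.1 p.2).card : ℝ) + 1)) / 2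

/-- The associahedron value `z_{[n]} = n(n+1)/2`. -/
noncomputable def znAs (n : ℕ) : ℝ := ((n : ℝ) * ((n : ℝ) + 1)) / 2


lemma aI_mem (D I : Finset ℕ) (h0 : ∀ i ∈ I, 0 < i) :
    (aI D I = 0 ∨ aI D I ∈ D) ∧ ∀ i ∈ I, aI D I < i := by
  have hne : ((insert 0 D).filter fun e => ∀ i ∈ I, e < i).Nonempty :=
    ⟨0, by simpa using h0⟩
  obtain ⟨e, he, hs⟩ := Finset.exists_mem_eq_sup _ hne id
  have : aI D I = e := hs
  rw [this]
  simpa using he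

lemma aI_max (D I : Finset ℕ) (e : ℕ) (he : e ∈ D) (h : ∀ i ∈ I, e < i) : e ≤ aI D I := by
  have hm : e ∈ ((insert 0 D).filter fun e => ∀ i ∈ I, e < i) := by
    simp [he]; exact h
  exact Finset.le_sup (f := id) hm

lemma bI_mem (n : ℕ) (D I : Finset ℕ) (h0 : ∀ i ∈ I, i ≤ n) :
    (bI n D I = n + 1 ∨ bI n D I ∈ D) ∧ ∀ i ∈ I, i < bI n D I := by
  have hne : {e : ℕ | e ∈ insert (n + 1) D ∧ ∀ i ∈ I, i < e}.Nonempty :=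
    ⟨n + 1, by simp, fun i hi => Nat.lt_succ_of_le (h0 i hi)⟩
  have := Nat.sInf_mem hne
  simpa [bI] using this

lemma bI_min (n : ℕ) (D I : Finset ℕ) (e : ℕ) (he : e ∈ insert (n + 1) D)
    (h : ∀ i ∈ I, i < e) : bI n D I ≤ e :=
  Nat.sInf_le ⟨he, h⟩

/-- The facts about `a(I)` and `b(I)` in one package. -/
lemma ab_spec (n : ℕ) (D I : Finset ℕ) (hI : I ⊆ Finset.Icc 1 n) :
    ((aI D I = 0 ∨ aI D I ∈ D) ∧ (∀ i ∈ I, aI D I < i) ∧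
      (∀ e ∈ D, (∀ i ∈ I, e < i) → e ≤ aI D I)) ∧
    ((bI n D I = n + 1 ∨ bI n D I ∈ D) ∧ (∀ i ∈ I, i < bI n D I) ∧ bI n D I ≤ n + 1 ∧
      (∀ e ∈ D, (∀ i ∈ I, i < e) → bI n D I ≤ e)) := by
  have h1 : ∀ i ∈ I, 0 < i := fun i hi => (Finset.mem_Icc.1 (hI hi)).1
  have h2 : ∀ i ∈ I, i ≤ n := fun i hi => (Finset.mem_Icc.1 (hI hi)).2
  refine ⟨⟨(aI_mem D I h1).1, (aI_mem D I h1).2, fun e => aI_max D I e⟩,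
    (bI_mem n D I h2).1, (bI_mem n D I h2).2, ?_, ?_⟩
  · exact bI_min n D I _ (by simp) (fun i hi => Nat.lt_succ_of_le (h2 i hi))
  · exact fun e he => bI_min n D I e (by simp [he])

lemma ex_max (S : Finset ℕ) (i : ℕ) :
    (∀ u ∈ S, ¬ u < i) ∨ ∃ x ∈ S, x < i ∧ ∀ u ∈ S, u < i → u ≤ x := by
  by_cases h : (S.filter (· < i)).Nonempty
  · right
    obtain ⟨x, hx, hm⟩ := Finset.exists_max_image _ id h
    simp only [Finset.mem_filter, id] at hx hm
    exact ⟨x, hx.1, hx.2, fun u h1 h2 => hm u ⟨h1, h2⟩⟩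
  · left
    intro u hu hlt
    exact h ⟨u, by simp [hu, hlt]⟩

lemma ex_min (S : Finset ℕ) (i : ℕ) :
    (∀ u ∈ S, ¬ i < u) ∨ ∃ x ∈ S, i < x ∧ ∀ u ∈ S, i < u → x ≤ u := by
  by_cases h : (S.filter (i < ·)).Nonempty
  · right
    obtain ⟨x, hx, hm⟩ := Finset.exists_min_image _ id h
    simp only [Finset.mem_filter, id] at hx hm
    exact ⟨x, hx.1, hx.2, fun u h1 h2 => hm u ⟨h1, h2⟩⟩
  · left
    intro u hu hlt
    exact h ⟨u, by simp [hu, hlt]⟩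

lemma mem_Rdiag (n : ℕ) (D U : Finset ℕ) (x y i : ℕ) :
    i ∈ Rdiag n D U x y ↔
      (i ∈ D ∧ (x ∉ U → x < i) ∧ (y ∉ U → i < y)) ∨
      (i ∈ U ∧ ((x ∈ U ∧ i ≤ x) ∨ (y ∈ U ∧ y ≤ i))) := by
  unfold Rdiag
  split_ifs <;> simp [*] <;> tauto

section
variable {n : ℕ} {D U : Finset ℕ}

lemma singleton_nested (hDU : D ∪ U = Finset.Icc 1 n) (i : ℕ) (hi : i ∈ Finset.Icc 1 n) :
    IsNested n D {i} := by
  have hs : ({i} : Finset ℕ) ⊆ Finset.Icc 1 n := by simpa using hi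
  obtain ⟨⟨ha1, ha2, ha3⟩, hb1, hb2, hb3, hb4⟩ := ab_spec n D {i} hs
  refine ⟨by simp, hs, fun d hd h1 h2 => ?_⟩
  simp only [Finset.mem_singleton, forall_eq] at *
  have := ha3 d hd
  have := hb4 d hd
  omega

lemma union_nested (J K : Finset ℕ) (hJ : IsNested n D J) (hK : IsNested n D K) (i : ℕ)
    (hiJ : i ∈ J) (hiK : i ∈ K) : IsNested n D (J ∪ K) := by
  have hs : J ∪ K ⊆ Finset.Icc 1 n := Finset.union_subset hJ.2.1 hK.2.1
  obtain ⟨⟨ha1, ha2, ha3⟩, hb1, hb2, hb3, hb4⟩ := ab_spec n D (J ∪ K) hs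
  obtain ⟨⟨ja1, ja2, ja3⟩, jb1, jb2, jb3, jb4⟩ := ab_spec n D J hJ.2.1
  obtain ⟨⟨ka1, ka2, ka3⟩, kb1, kb2, kb3, kb4⟩ := ab_spec n D K hK.2.1
  refine ⟨⟨i, by simp [hiJ]⟩, hs, fun d hd h1 h2 => ?_⟩
  by_contra hc
  have hcJ : d ∉ J := fun h => hc (by simp [h])
  have hcK : d ∉ K := fun h => hc (by simp [h])
  have h1' : ¬ ∀ i ∈ J ∪ K, d < i := fun h => absurd (ha3 d hd h) (by omega)
  have h2' : ¬ ∀ i ∈ J ∪ K, i < d := fun h => absurd (hb4 d hd h) (by omega)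
  have hj : ¬ (aI D J < d ∧ d < bI n D J) := fun h => hcJ (hJ.2.2 d hd h.1 h.2)
  have hk : ¬ (aI D K < d ∧ d < bI n D K) := fun h => hcK (hK.2.2 d hd h.1 h.2)
  have := ja2 i hiJ
  have := jb2 i hiJ
  have := ka2 i hiK
  have := kb2 i hiK
  rcases lt_or_ge (aI D J) d with h | h
  · rcases lt_or_ge (aI D K) d with h' | h'
    · apply h2'
      intro t ht
      rcases Finset.mem_union.1 ht with ht | ht
      · have := jb2 t ht; omega
      · have := kb2 t ht; omega
    · omega
  · rcases lt_or_ge (aI D K) d with h' | h'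
    · omega
    · apply h1'
      intro t ht
      rcases Finset.mem_union.1 ht with ht | ht
      · have := ja2 t ht; omega
      · have := ka2 t ht; omega

lemma sum_components (hDU : D ∪ U = Finset.Icc 1 n) (I : Finset ℕ) (hI : I ⊆ Finset.Icc 1 n)
    (x : ℕ → ℝ) : ∑ J ∈ nestedComponents n D I, ∑ i ∈ J, x i = ∑ i ∈ I, x i := by
  have hmem : ∀ J, J ∈ nestedComponents n D I ↔ J ⊆ I ∧ IsNested n D J ∧
      ∀ K ⊆ I, IsNested n D K → J ⊆ K → J = K := by
    intro J; simp [nestedComponents]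
  have hdis : (↑(nestedComponents n D I) : Set (Finset ℕ)).PairwiseDisjoint id := by
    intro J hJ K hK hne
    have hJ := (hmem J).1 hJ
    have hK := (hmem K).1 hK
    show Disjoint J K
    rw [Finset.disjoint_left]
    intro i hiJ hiK
    have hn := union_nested J K hJ.2.1 hK.2.1 i hiJ hiK
    have hu := Finset.union_subset hJ.1 hK.1
    exact hne ((hJ.2.2 _ hu hn Finset.subset_union_left).trans
      (hK.2.2 _ hu hn Finset.subset_union_right).symm)
  have hsb := Finset.sum_biUnion (f := x) hdis
  simp only [id] at hsb
  rw [← hsb]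
  congr 1
  ext i
  simp only [Finset.mem_biUnion, id]
  constructor
  · rintro ⟨J, hJ, hi⟩
    exact ((hmem J).1 hJ).1 hi
  · intro hi
    have hne : (I.powerset.filter fun K => IsNested n D K ∧ i ∈ K).Nonempty :=
      ⟨{i}, by simp [hi, singleton_nested hDU i (hI hi)]⟩
    obtain ⟨J, hJ, hmax⟩ := Finset.exists_max_image _ Finset.card hne
    simp only [Finset.mem_filter, Finset.mem_powerset] at hJ hmax
    refine ⟨J, (hmem J).2 ⟨hJ.1, hJ.2.1, fun K hK hKn hJK => ?_⟩, hJ.2.2⟩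
    exact Finset.eq_of_subset_of_card_le hJK (hmax K ⟨hK, hKn, hJK hJ.2.2⟩)

lemma mem_WJ (J : Finset ℕ) (p : ℕ × ℕ) :
    p ∈ WJ n D U J ↔ AssocDiag n D U J p.1 p.2 ∧ IsProper n D U p.1 p.2 := by
  simp only [WJ, Finset.mem_filter, Finset.mem_product, Finset.mem_range]
  constructor
  · exact fun h => h.2
  · intro h
    have h1 := h.2.1
    have h2 := h.2.2.1
    exact ⟨⟨by omega, by omega⟩, h⟩

lemma Rdiag_subset (hDU : D ∪ U = Finset.Icc 1 n) (x y : ℕ) :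
    Rdiag n D U x y ⊆ Finset.Icc 1 n := by
  intro i hi
  rw [← hDU, Finset.mem_union]
  rw [mem_Rdiag] at hi
  tauto

lemma mem_DU (hDU : D ∪ U = Finset.Icc 1 n) (i : ℕ) : (i ∈ D ∨ i ∈ U) ↔ (1 ≤ i ∧ i ≤ n) := by
  rw [← Finset.mem_union, hDU, Finset.mem_Icc]

/-- Everything needed about the associated diagonals. -/
lemma assoc_facts (hDU : D ∪ U = Finset.Icc 1 n) (hdisj : Disjoint D U)
    (J : Finset ℕ) (hJ : IsNested n D J) :
    aI D J ∉ U ∧ bI n D J ∉ U ∧ aI D J < bI n D J := by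
  obtain ⟨⟨ja1, ja2, ja3⟩, jb1, jb2, jb3, jb4⟩ := ab_spec n D J hJ.2.1
  have hm := mem_DU hDU
  have hd := Finset.disjoint_left.1 hdisj
  obtain ⟨i, hi⟩ := hJ.1
  refine ⟨fun h => ?_, fun h => ?_, (ja2 i hi).trans (jb2 i hi)⟩
  · rcases ja1 with h' | h'
    · have := (hm _).1 (Or.inr h); omega
    · exact hd h' h
  · rcases jb1 with h' | h'
    · have := (hm _).1 (Or.inr h); omega
    · exact hd h' h

lemma assoc_disj (hDU : D ∪ U = Finset.Icc 1 n) (hdisj : Disjoint D U)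
    (J : Finset ℕ) (hJ : IsNested n D J) (x y x' y' i : ℕ)
    (h : AssocDiag n D U J x y) (h' : AssocDiag n D U J x' y')
    (hi : i ∈ Finset.Icc 1 n)
    (hR : i ∉ Rdiag n D U x y) (hR' : i ∉ Rdiag n D U x' y') : x = x' ∧ y = y' := by
  obtain ⟨⟨ja1, ja2, ja3⟩, jb1, jb2, jb3, jb4⟩ := ab_spec n D J hJ.2.1
  obtain ⟨haU, hbU, hab⟩ := assoc_facts hDU hdisj J hJ
  have hd : ∀ i, i ∈ D → i ∉ U := fun i h => Finset.disjoint_left.1 hdisj h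
  rw [mem_Rdiag] at hR hR'
  obtain ⟨hxy, hx, hy, hg⟩ := h
  obtain ⟨hxy', hx', hy', hg'⟩ := h'
  have ex : x = aI D J ∧ x ∉ U ∨ x ∈ J ∧ x ∈ U := by
    rcases hx with h | h
    · exact Or.inl ⟨h, h ▸ haU⟩
    · exact Or.inr ⟨h.1, h.2.1⟩
  have ex' : x' = aI D J ∧ x' ∉ U ∨ x' ∈ J ∧ x' ∈ U := by
    rcases hx' with h | h
    · exact Or.inl ⟨h, h ▸ haU⟩
    · exact Or.inr ⟨h.1, h.2.1⟩
  have ey : y = bI n D J ∧ y ∉ U ∨ y ∈ J ∧ y ∈ U := by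
    rcases hy with h | h
    · exact Or.inl ⟨h, h ▸ hbU⟩
    · exact Or.inr ⟨h.1, h.2.1⟩
  have ey' : y' = bI n D J ∧ y' ∉ U ∨ y' ∈ J ∧ y' ∈ U := by
    rcases hy' with h | h
    · exact Or.inl ⟨h, h ▸ hbU⟩
    · exact Or.inr ⟨h.1, h.2.1⟩
  clear hx hx' hy hy'
  simp only [Finset.mem_inter, and_imp] at hg hg'
  have g1 := hg x'
  have g2 := hg y'
  have g3 := hg' x
  have g4 := hg' y
  have p1 := ja2 x
  have p2 := ja2 y
  have p3 := ja2 x'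
  have p4 := ja2 y'
  have q1 := jb2 x
  have q2 := jb2 y
  have q3 := jb2 x'
  have q4 := jb2 y'
  have hDUi : i ∈ D ∨ i ∈ U := by rw [mem_DU hDU]; simpa using hi
  have hdi := hd i
  clear hg hg' ja1 ja2 ja3 jb1 jb2 jb3 jb4 hd hi hDU hdisj
  generalize aI D J = a at *
  generalize bI n D J = b at *
  rcases ex with ⟨rfl, ex⟩ | ⟨ex1, ex⟩ <;> rcases ex' with ⟨rfl, ex'⟩ | ⟨ex1', ex'⟩ <;>
  rcases ey with ⟨rfl, ey⟩ | ⟨ey1, ey⟩ <;> rcases ey' with ⟨rfl, ey'⟩ | ⟨ey1', ey'⟩ <;>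
  rcases hDUi with hi | hi <;>
  simp only [*, not_true_eq_false, not_false_eq_true, true_and, false_and, and_true, and_false,
    or_false, false_or, true_imp_iff, forall_const, false_imp_iff, imp_false,
    IsEmpty.forall_iff] at * <;> omega

lemma J_sub_R (hdisj : Disjoint D U)
    (hDU : D ∪ U = Finset.Icc 1 n)
    (J : Finset ℕ) (hJ : IsNested n D J) (x y i : ℕ)
    (h : AssocDiag n D U J x y) (hi : i ∈ J) : i ∈ Rdiag n D U x y := by
  obtain ⟨⟨ja1, ja2, ja3⟩, jb1, jb2, jb3, jb4⟩ := ab_spec n D J hJ.2.1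
  obtain ⟨haU, hbU, hab⟩ := assoc_facts hDU hdisj J hJ
  obtain ⟨hxy, hx, hy, hg⟩ := h
  have hDUi : i ∈ D ∨ i ∈ U := by rw [mem_DU hDU]; simpa using hJ.2.1 hi
  have ex : x = aI D J ∨ x ∈ J ∧ x ∈ U := hx.imp id (fun h => ⟨h.1, h.2.1⟩)
  have ey : y = bI n D J ∨ y ∈ J ∧ y ∈ U := hy.imp id (fun h => ⟨h.1, h.2.1⟩)
  have h1 := ja2 i hi
  have h2 := jb2 i hi
  have hg := hg i
  rw [mem_Rdiag]
  simp only [Finset.mem_inter] at hg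
  clear ja1 ja2 ja3 jb1 jb2 jb3 jb4
  grind

lemma exists_assoc (hDU : D ∪ U = Finset.Icc 1 n) (hdisj : Disjoint D U)
    (J : Finset ℕ) (hJ : IsNested n D J) (i : ℕ) (hi : i ∈ Finset.Icc 1 n) (hiJ : i ∉ J) :
    ∃ x y, AssocDiag n D U J x y ∧ IsProper n D U x y ∧ i ∉ Rdiag n D U x y := by
  obtain ⟨⟨ja1, ja2, ja3⟩, jb1, jb2, jb3, jb4⟩ := ab_spec n D J hJ.2.1
  obtain ⟨haU, hbU, hab⟩ := assoc_facts hDU hdisj J hJ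
  have hd : ∀ i, i ∈ D → i ∉ U := fun i h => Finset.disjoint_left.1 hdisj h
  have hm := mem_DU hDU
  have hDUi : i ∈ D ∨ i ∈ U := by rw [hm]; simpa using hi
  have hJD := hJ.2.2
  obtain ⟨k, hk⟩ := hJ.1
  have hkDU : k ∈ D ∨ k ∈ U := by rw [hm]; simpa using hJ.2.1 hk
  have hki := ja2 k hk
  have hki' := jb2 k hk
  have hi' := Finset.mem_Icc.1 hi
  -- the position used for the search
  obtain ⟨t, ht1, ht2, ht3, htJ⟩ : ∃ t, (i ∈ U → t = i) ∧ (i ∈ D → i ≤ aI D J → t = aI D J) ∧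
      (i ∈ D → bI n D J ≤ i → t = bI n D J) ∧ ¬ (t ∈ J ∧ t ∈ U) := by
    rcases hDUi with h | h
    · by_cases h' : i ≤ aI D J
      · refine ⟨aI D J, fun hu => absurd hu (hd i h), fun _ _ => rfl, fun _ _ => by omega,
          fun h => haU h.2⟩
      · refine ⟨bI n D J, fun hu => absurd hu (hd i h), fun _ _ => by omega, fun _ _ => rfl,
          fun h => hbU h.2⟩
    · exact ⟨i, fun _ => rfl, fun h' => absurd h (hd i h'), fun h' => absurd h (hd i h'),
        fun h => hiJ h.1⟩
  have hiab : i ∈ D → i ≤ aI D J ∨ bI n D J ≤ i := by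
    intro h
    by_contra hc
    push Not at hc
    exact hiJ (hJD i h hc.1 hc.2)
  -- left endpoint
  obtain ⟨x, hx, hx0, hx1, hx2⟩ : ∃ x, (x = aI D J ∨ IsRunEnd U J x) ∧
      ((x = aI D J ∧ x ∉ U ∧ ∀ u ∈ J, u ∈ U → t ≤ u) ∨ (x ∈ J ∧ x ∈ U ∧ x < t)) ∧
      (∀ u ∈ J, u ∈ U → u < t → u ≤ x) ∧ aI D J ≤ x := by
    rcases ex_max (J ∩ U) t with h | ⟨x, hx, hxt, hmx⟩
    · simp only [Finset.mem_inter, and_imp, not_lt] at h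
      exact ⟨aI D J, Or.inl rfl, Or.inl ⟨rfl, haU, h⟩, fun u h1 h2 h3 => by
        have := h u h1 h2; omega, le_rfl⟩
    · simp only [Finset.mem_inter, and_imp] at hx hmx
      refine ⟨x, Or.inr ⟨hx.1, hx.2, fun y hy hyJ => ?_⟩, Or.inr ⟨hx.1, hx.2, hxt⟩, hmx,
        (ja2 x hx.1).le⟩
      obtain ⟨_, hyU, hxy, hyc⟩ := hy
      have h1 := hmx y hyJ hyU
      have h3 : y ≠ t := fun h => htJ (h ▸ ⟨hyJ, hyU⟩)
      by_cases hiU : i ∈ U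
      · have hti := ht1 hiU
        have h2 := hyc i hiU
        omega
      · have hiD : i ∈ D := hDUi.resolve_right hiU
        have h4 := ja2 x hx.1
        have h5 := jb2 y hyJ
        rcases hiab hiD with h | h
        · have := ht2 hiD h; omega
        · have := ht3 hiD h; omega
  obtain ⟨y, hy, hy0, hy1, hy2⟩ : ∃ y, (y = bI n D J ∨ IsRunStart U J y) ∧
      ((y = bI n D J ∧ y ∉ U ∧ ∀ u ∈ J, u ∈ U → u ≤ t) ∨ (y ∈ J ∧ y ∈ U ∧ t < y)) ∧
      (∀ u ∈ J, u ∈ U → t < u → y ≤ u) ∧ y ≤ bI n D J := by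
    rcases ex_min (J ∩ U) t with h | ⟨y, hy, hyt, hmy⟩
    · simp only [Finset.mem_inter, and_imp, not_lt] at h
      exact ⟨bI n D J, Or.inl rfl, Or.inl ⟨rfl, hbU, h⟩, fun u h1 h2 h3 => by
        have := h u h1 h2; omega, le_rfl⟩
    · simp only [Finset.mem_inter, and_imp] at hy hmy
      refine ⟨y, Or.inr ⟨hy.1, hy.2, fun x hx hxJ => ?_⟩, Or.inr ⟨hy.1, hy.2, hyt⟩, hmy,
        (jb2 y hy.1).le⟩
      obtain ⟨hxU, _, hxy, hyc⟩ := hx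
      have h1 := hmy x hxJ hxU
      have h3 : x ≠ t := fun h => htJ (h ▸ ⟨hxJ, hxU⟩)
      by_cases hiU : i ∈ U
      · have hti := ht1 hiU
        have h2 := hyc i hiU
        omega
      · have hiD : i ∈ D := hDUi.resolve_right hiU
        have h4 := ja2 x hxJ
        have h5 := jb2 y hy.1
        rcases hiab hiD with h | h
        · have := ht2 hiD h; omega
        · have := ht3 hiD h; omega
  have hxU' : x ∈ U → x ∈ J ∧ x < t := fun h => by
    rcases hx0 with h' | h'
    · exact absurd h h'.2.1
    · exact ⟨h'.1, h'.2.2⟩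
  have hyU' : y ∈ U → y ∈ J ∧ t < y := fun h => by
    rcases hy0 with h' | h'
    · exact absurd h h'.2.1
    · exact ⟨h'.1, h'.2.2⟩
  have hxN : x ∉ U → x = aI D J ∧ ∀ u ∈ J, u ∈ U → t ≤ u := fun h => by
    rcases hx0 with h' | h'
    · exact ⟨h'.1, h'.2.2⟩
    · exact absurd h'.2.1 h
  have hyN : y ∉ U → y = bI n D J ∧ ∀ u ∈ J, u ∈ U → u ≤ t := fun h => by
    rcases hy0 with h' | h'
    · exact ⟨h'.1, h'.2.2⟩
    · exact absurd h'.2.1 h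
  have hxy : x < y := by
    rcases hx0 with ⟨h, _, _⟩ | ⟨h, _, _⟩ <;> rcases hy0 with ⟨h', _, _⟩ | ⟨h', _, _⟩
    · omega
    · have := ja2 y h'; omega
    · have := jb2 x h; omega
    · omega
  refine ⟨x, y, ⟨hxy, hx, hy, ?_⟩, ⟨hxy, hy2.trans jb3, ?_⟩, ?_⟩
  · intro u hu hc
    rw [Finset.mem_inter] at hu
    have h1 := hx1 u hu.1 hu.2
    have h2 := hy1 u hu.1 hu.2
    have : u ≠ t := fun h => htJ (h ▸ hu)
    omega
  · rintro (hb | ⟨-, hb | hb | hb⟩ | hb)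
    · obtain ⟨hb1, hb2, -, hb4⟩ := hb
      have key : ∀ v, v ∈ Dbar n D → v ∉ U := by
        intro v hv hvU
        have := (hm v).1 (Or.inr hvU)
        simp only [Dbar, Finset.mem_insert] at hv
        rcases hv with h | h | h
        · omega
        · omega
        · exact hd v h hvU
      have hxU := key x hb1
      have hyU := key y hb2
      have hxa : x = aI D J ∧ ∀ u ∈ J, u ∈ U → t ≤ u := hxN hxU
      have hyb : y = bI n D J ∧ ∀ u ∈ J, u ∈ U → u ≤ t := hyN hyU
      rcases hkDU with h | h
      · exact hb4 k (by simp [Dbar, h]) ⟨by omega, by omega⟩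
      · have h1 := hxa.2 k hk h
        have h2 := hyb.2 k hk h
        have : k = t := by omega
        exact htJ (this ▸ ⟨hk, h⟩)
    · obtain ⟨h0, hyU, hb⟩ := hb
      have hyt : t < y := (hyU' hyU).2
      rcases hDUi with h | h
      · rcases hiab h with h' | h'
        · omega
        · have h3 := ht3 h h'
          have : y ∈ J := (hyU' hyU).1
          have := jb2 y this
          omega
      · have := hb i h
        have := ht1 h
        omega
    · obtain ⟨h0, hxU, hb⟩ := hb
      have hxt : x < t := (hxU' hxU).2
      rcases hDUi with h | h
      · rcases hiab h with h' | h'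
        · have h3 := ht2 h h'
          have : x ∈ J := (hxU' hxU).1
          have := ja2 x this
          omega
        · omega
      · have := hb i h
        have := ht1 h
        omega
    · obtain ⟨hxU, hyU, -, hb⟩ := hb
      have hxt : x < t ∧ x ∈ J := (hxU' hxU).symm
      have hyt : t < y ∧ y ∈ J := (hyU' hyU).symm
      have := ja2 x hxt.2
      have := jb2 y hyt.2
      rcases hDUi with h | h
      · rcases hiab h with h' | h'
        · have h3 := ht2 h h'
          omega
        · have h3 := ht3 h h'
          omega
      · have := hb i h
        have := ht1 h
        omega
    · obtain ⟨hU, h0, h1⟩ := hb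
      subst hU
      have h : i ∈ D := by simpa using hDUi
      rcases hiab h with h' | h' <;> omega
  · rw [mem_Rdiag]
    rintro (⟨h, h1, h2⟩ | ⟨h, h1⟩)
    · rcases hiab h with h' | h'
      · have h3 := ht2 h h'
        have hxU : x ∉ U := by
          intro hxU
          have hxt : x < t ∧ x ∈ J := (hxU' hxU).symm
          have := ja2 x hxt.2
          omega
        have := h1 hxU
        omega
      · have h3 := ht3 h h'
        have hyU : y ∉ U := by
          intro hyU
          have hyt : t < y ∧ y ∈ J := (hyU' hyU).symm
          have := jb2 y hyt.2
          omega
        have := h2 hyU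
        have : y = bI n D J := (hyN hyU).1
        omega
    · have := ht1 h
      rcases h1 with ⟨hU, hl⟩ | ⟨hU, hl⟩
      · have : x < t := (hxU' hU).2
        omega
      · have : t < y := (hyU' hU).2
        omega

lemma sum_nested (hDU : D ∪ U = Finset.Icc 1 n) (hdisj : Disjoint D U)
    (J : Finset ℕ) (hJ : IsNested n D J) (x : ℕ → ℝ) :
    ∑ i ∈ J, x i = (∑ p ∈ WJ n D U J, ∑ i ∈ Rdiag n D U p.1 p.2, x i)
      - (((WJ n D U J).card : ℝ) - 1) * ∑ i ∈ Finset.Icc 1 n, x i := by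
  have hdis : (↑(WJ n D U J) : Set (ℕ × ℕ)).PairwiseDisjoint
      (fun p => Finset.Icc 1 n \ Rdiag n D U p.1 p.2) := by
    intro p hp q hq hne
    have hp := (mem_WJ J p).1 hp
    have hq := (mem_WJ J q).1 hq
    show Disjoint (Finset.Icc 1 n \ Rdiag n D U p.1 p.2) (Finset.Icc 1 n \ Rdiag n D U q.1 q.2)
    rw [Finset.disjoint_left]
    intro i h1 h2
    rw [Finset.mem_sdiff] at h1 h2
    have := assoc_disj hDU hdisj J hJ _ _ _ _ i hp.1 hq.1 h1.1 h1.2 h2.2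
    exact hne (Prod.ext this.1 this.2)
  have hU : (WJ n D U J).biUnion (fun p => Finset.Icc 1 n \ Rdiag n D U p.1 p.2)
      = Finset.Icc 1 n \ J := by
    ext i
    simp only [Finset.mem_biUnion, Finset.mem_sdiff]
    constructor
    · rintro ⟨p, hp, hi, hR⟩
      exact ⟨hi, fun h => hR (J_sub_R hdisj hDU J hJ _ _ i ((mem_WJ J p).1 hp).1 h)⟩
    · rintro ⟨hi, hiJ⟩
      obtain ⟨a, b, h1, h2, h3⟩ := exists_assoc hDU hdisj J hJ i hi hiJ
      exact ⟨(a, b), (mem_WJ J _).2 ⟨h1, h2⟩, hi, h3⟩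
  have hs := Finset.sum_biUnion (f := x) hdis
  rw [hU] at hs
  have h1 := Finset.sum_sdiff (f := x) hJ.2.1
  have h2 : ∀ p ∈ WJ n D U J, ∑ i ∈ Finset.Icc 1 n \ Rdiag n D U p.1 p.2, x i
      = (∑ i ∈ Finset.Icc 1 n, x i) - ∑ i ∈ Rdiag n D U p.1 p.2, x i := by
    intro p _
    have := Finset.sum_sdiff (f := x) (Rdiag_subset hDU p.1 p.2)
    linarith
  rw [Finset.sum_congr rfl h2, Finset.sum_sub_distrib, Finset.sum_const, nsmul_eq_mul] at hs
  linarith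

lemma part1 (hDU : D ∪ U = Finset.Icc 1 n) (hdisj : Disjoint D U)
    (w : ℕ × ℕ → ℝ) (zn : ℝ) (x : ℕ → ℝ) (hx : (∑ i ∈ Finset.Icc 1 n, x i) = zn)
    (hw : ∀ a b : ℕ, IsProper n D U a b → w (a, b) ≤ ∑ i ∈ Rdiag n D U a b, x i)
    (I : Finset ℕ) (hI : I ⊆ Finset.Icc 1 n) : zc n D U w zn I ≤ ∑ i ∈ I, x i := by
  rw [← sum_components hDU I hI x, zc]
  apply Finset.sum_le_sum
  intro J hJ
  have hJn : IsNested n D J := by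
    simp only [nestedComponents, Finset.mem_filter] at hJ
    exact hJ.2.1
  rw [sum_nested hDU hdisj J hJn x, hx]
  apply sub_le_sub_right
  apply Finset.sum_le_sum
  intro p hp
  exact hw p.1 p.2 ((mem_WJ J p).1 hp).2

lemma R_ab (hDU : D ∪ U = Finset.Icc 1 n) (hdisj : Disjoint D U) (h1D : 1 ∈ D) (hnD : n ∈ D)
    (x y : ℕ) (hp : IsProper n D U x y) :
    (Rdiag n D U x y).Nonempty ∧
    aI D (Rdiag n D U x y) = (if x ∈ U then 0 else x) ∧
    bI n D (Rdiag n D U x y) = (if y ∈ U then n + 1 else y) := by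
  obtain ⟨⟨ja1, ja2, ja3⟩, jb1, jb2, jb3, jb4⟩ := ab_spec n D _ (Rdiag_subset hDU x y)
  have hd : ∀ i, i ∈ D → i ∉ U := fun i h => Finset.disjoint_left.1 hdisj h
  have hm := mem_DU hDU
  obtain ⟨hxy, hyn, hnb⟩ := hp
  have hxD : x ∉ U → x ∉ D → x = 0 := by
    intro h1 h2
    by_contra h0
    have := (hm x).2 ⟨by omega, by omega⟩
    tauto
  have hyD : y ∉ U → y ∉ D → y = n + 1 := by
    intro h1 h2
    by_contra h0
    have := (hm y).2 ⟨by omega, by omega⟩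
    tauto
  -- the D-part is nonempty
  have hne : ∃ d ∈ D, d ∈ Rdiag n D U x y := by
    by_cases hxU : x ∈ U
    · refine ⟨1, h1D, ?_⟩
      rw [mem_Rdiag]
      have := (hm x).1 (Or.inr hxU)
      exact Or.inl ⟨h1D, fun h => absurd hxU h, fun _ => by omega⟩
    · by_cases hyU : y ∈ U
      · refine ⟨n, hnD, ?_⟩
        rw [mem_Rdiag]
        have := (hm y).1 (Or.inr hyU)
        exact Or.inl ⟨hnD, fun _ => by omega, fun h => absurd hyU h⟩
      · by_contra hc
        push Not at hc
        apply hnb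
        left
        refine ⟨?_, ?_, hxy, ?_⟩
        · simp only [Dbar, Finset.mem_insert]; tauto
        · simp only [Dbar, Finset.mem_insert]; tauto
        · rintro z hz ⟨h1, h2⟩
          simp only [Dbar, Finset.mem_insert] at hz
          have hzD : z ∈ D := by
            rcases hz with h | h | h
            · omega
            · omega
            · exact h
          apply hc z hzD
          rw [mem_Rdiag]
          exact Or.inl ⟨hzD, fun _ => h1, fun _ => h2⟩
  obtain ⟨d, hdD, hdR⟩ := hne
  refine ⟨⟨d, hdR⟩, ?_, ?_⟩
  · split_ifs with hxU
    · have h1 : (1 : ℕ) ∈ Rdiag n D U x y := by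
        rw [mem_Rdiag]
        have := (hm x).1 (Or.inr hxU)
        exact Or.inl ⟨h1D, fun h => absurd hxU h, fun _ => by omega⟩
      have := ja2 1 h1
      omega
    · apply le_antisymm
      · by_contra hc
        push Not at hc
        have hdx := (mem_Rdiag n D U x y d).1 hdR
        have hdlt := ja2 d hdR
        have haD : aI D (Rdiag n D U x y) ∈ D := by
          rcases ja1 with h | h
          · omega
          · exact h
        have hdy : y ∉ U → d < y := by
          have := hd d hdD
          tauto
        have : aI D (Rdiag n D U x y) ∈ Rdiag n D U x y := by
          rw [mem_Rdiag]
          exact Or.inl ⟨haD, fun _ => hc, fun h => hdlt.trans (hdy h)⟩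
        exact absurd (ja2 _ this) (lt_irrefl _)
      · by_cases h : x ∈ D
        · apply ja3 x h
          intro i hi
          rw [mem_Rdiag] at hi
          rcases hi with hi | ⟨_, hi | hi⟩
          · exact hi.2.1 hxU
          · exact absurd hi.1 hxU
          · omega
        · have := hxD hxU h; omega
  · split_ifs with hyU
    · have h1 : n ∈ Rdiag n D U x y := by
        rw [mem_Rdiag]
        have := (hm y).1 (Or.inr hyU)
        exact Or.inl ⟨hnD, fun _ => by omega, fun h => absurd hyU h⟩
      have := jb2 n h1
      omega
    · apply le_antisymm
      · by_cases h : y ∈ D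
        · apply jb4 y h
          intro i hi
          rw [mem_Rdiag] at hi
          rcases hi with hi | ⟨_, hi | hi⟩
          · exact hi.2.2 hyU
          · omega
          · exact absurd hi.1 hyU
        · have := hyD hyU h; omega
      · by_contra hc
        push Not at hc
        have hdx := (mem_Rdiag n D U x y d).1 hdR
        have hdlt := jb2 d hdR
        have hbD : bI n D (Rdiag n D U x y) ∈ D := by
          rcases jb1 with h | h
          · omega
          · exact h
        have hdy : x ∉ U → x < d := by
          have := hd d hdD
          tauto
        have : bI n D (Rdiag n D U x y) ∈ Rdiag n D U x y := by
          rw [mem_Rdiag]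
          exact Or.inl ⟨hbD, fun h => (hdy h).trans hdlt, fun _ => hc⟩
        exact absurd (jb2 _ this) (lt_irrefl _)

lemma R_nested (hDU : D ∪ U = Finset.Icc 1 n) (hdisj : Disjoint D U) (h1D : 1 ∈ D) (hnD : n ∈ D)
    (x y : ℕ) (hp : IsProper n D U x y) : IsNested n D (Rdiag n D U x y) := by
  obtain ⟨h1, h2, h3⟩ := R_ab hDU hdisj h1D hnD x y hp
  refine ⟨h1, Rdiag_subset hDU x y, fun d hd ha hb => ?_⟩
  rw [h2] at ha
  rw [h3] at hb
  rw [mem_Rdiag]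
  exact Or.inl ⟨hd, fun h => by simpa [h] using ha, fun h => by simpa [h] using hb⟩

lemma proper_misses (hDU : D ∪ U = Finset.Icc 1 n) (hdisj : Disjoint D U)
    (x y : ℕ) (hp : IsProper n D U x y) : ∃ i ∈ Finset.Icc 1 n, i ∉ Rdiag n D U x y := by
  by_contra hc
  push Not at hc
  have hd : ∀ i, i ∈ D → i ∉ U := fun i h => Finset.disjoint_left.1 hdisj h
  have hm := mem_DU hDU
  obtain ⟨hxy, hyn, hnb⟩ := hp
  have hR : ∀ u ∈ U, (x ∈ U ∧ u ≤ x) ∨ (y ∈ U ∧ y ≤ u) := by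
    intro u hu
    have h := hc u (by rw [← hDU]; exact Finset.mem_union_right _ hu)
    rw [mem_Rdiag] at h
    rcases h with h | h
    · exact absurd hu (hd u h.1)
    · exact h.2
  have hRD : ∀ d ∈ D, (x ∉ U → x < d) ∧ (y ∉ U → d < y) := by
    intro d hdD
    have h := hc d (by rw [← hDU]; exact Finset.mem_union_left _ hdD)
    rw [mem_Rdiag] at h
    rcases h with h | h
    · exact h.2
    · exact absurd h.1 (hd d hdD)
  have hx0 : x ∉ U → x = 0 := by
    intro hx
    by_contra h0
    have h := ((hm x).2 ⟨by omega, by omega⟩).resolve_right hx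
    exact absurd ((hRD x h).1 hx) (lt_irrefl _)
  have hyn' : y ∉ U → y = n + 1 := by
    intro hy
    by_contra h0
    have h := ((hm y).2 ⟨by omega, by omega⟩).resolve_right hy
    exact absurd ((hRD y h).2 hy) (lt_irrefl _)
  by_cases hx : x ∈ U
  · by_cases hy : y ∈ U
    · refine hnb (Or.inr (Or.inl ⟨⟨x, hx⟩, Or.inr (Or.inr ⟨hx, hy, hxy, fun z hz hlt => ?_⟩)⟩))
      have := hR z hz
      omega
    · refine hnb (Or.inr (Or.inl ⟨⟨x, hx⟩, Or.inr (Or.inl ⟨hyn' hy, hx, fun u hu => ?_⟩)⟩))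
      rcases hR u hu with h | h
      · exact h.2
      · exact absurd h.1 hy
  · by_cases hy : y ∈ U
    · refine hnb (Or.inr (Or.inl ⟨⟨y, hy⟩, Or.inl ⟨hx0 hx, hy, fun u hu => ?_⟩⟩))
      rcases hR u hu with h | h
      · exact absurd h.1 hx
      · exact h.2
    · refine hnb (Or.inr (Or.inr ⟨?_, hx0 hx, hyn' hy⟩))
      apply Finset.eq_empty_of_forall_notMem
      intro u hu
      rcases hR u hu with h | h
      · exact hx h.1
      · exact hy h.1

lemma R_WJ (hDU : D ∪ U = Finset.Icc 1 n) (hdisj : Disjoint D U) (h1D : 1 ∈ D) (hnD : n ∈ D)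
    (x y : ℕ) (hp : IsProper n D U x y) : WJ n D U (Rdiag n D U x y) = {(x, y)} := by
  have hJ := R_nested hDU hdisj h1D hnD x y hp
  obtain ⟨h1, h2, h3⟩ := R_ab hDU hdisj h1D hnD x y hp
  have hd : ∀ i, i ∈ D → i ∉ U := fun i h => Finset.disjoint_left.1 hdisj h
  have hm := mem_DU hDU
  have hR : ∀ u ∈ U, u ∈ Rdiag n D U x y ↔ (x ∈ U ∧ u ≤ x) ∨ (y ∈ U ∧ y ≤ u) := by
    intro u hu
    rw [mem_Rdiag]
    have : u ∉ D := fun h => hd u h hu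
    tauto
  have hA : AssocDiag n D U (Rdiag n D U x y) x y := by
    refine ⟨hp.1, ?_, ?_, ?_⟩
    · by_cases hx : x ∈ U
      · refine Or.inr ⟨(hR x hx).2 (Or.inl ⟨hx, le_rfl⟩), hx, fun z hz hzR => ?_⟩
        rw [hR z hz.2.1] at hzR
        have h4 := hz.2.2.1
        rcases hzR with h | h
        · omega
        · have h5 := hz.2.2.2 y h.1
          have h6 := hp.1
          have : z = y := by omega
          subst this
          exact hp.2.2 (Or.inr (Or.inl ⟨⟨x, hx⟩, Or.inr (Or.inr hz)⟩))
      · left; rw [h2, if_neg hx]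
    · by_cases hy : y ∈ U
      · refine Or.inr ⟨(hR y hy).2 (Or.inr ⟨hy, le_rfl⟩), hy, fun z hz hzR => ?_⟩
        rw [hR z hz.1] at hzR
        have h4 := hz.2.2.1
        rcases hzR with h | h
        · have h5 := hz.2.2.2 x h.1
          have h6 := hp.1
          have : z = x := by omega
          subst this
          exact hp.2.2 (Or.inr (Or.inl ⟨⟨z, h.1⟩, Or.inr (Or.inr hz)⟩))
        · omega
      · left; rw [h3, if_neg hy]
    · intro u hu hc
      rw [Finset.mem_inter, ] at hu
      have := (hR u hu.2).1 hu.1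
      omega
  ext p
  rw [mem_WJ, Finset.mem_singleton]
  constructor
  · rintro ⟨hpA, hpP⟩
    -- a proper diagonal misses some element
    obtain ⟨i, hi, hiR⟩ : ∃ i ∈ Finset.Icc 1 n, i ∉ Rdiag n D U p.1 p.2 :=
      proper_misses hDU hdisj p.1 p.2 hpP
    have hiJ : i ∉ Rdiag n D U x y := fun h =>
      hiR (J_sub_R hdisj hDU _ hJ _ _ i hpA h)
    have := assoc_disj hDU hdisj _ hJ _ _ _ _ i hpA hA hi hiR hiJ
    exact Prod.ext this.1 this.2
  · rintro rfl
    exact ⟨hA, hp⟩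

lemma part2 (hDU : D ∪ U = Finset.Icc 1 n) (hdisj : Disjoint D U) (h1D : 1 ∈ D) (hnD : n ∈ D)
    (w : ℕ × ℕ → ℝ) (zn : ℝ) (x y : ℕ) (hp : IsProper n D U x y) :
    zc n D U w zn (Rdiag n D U x y) = w (x, y) := by
  have hJ := R_nested hDU hdisj h1D hnD x y hp
  have : nestedComponents n D (Rdiag n D U x y) = {Rdiag n D U x y} := by
    ext K
    simp only [nestedComponents, Finset.mem_filter, Finset.mem_powerset, Finset.mem_singleton]
    constructor
    · rintro ⟨h1, h2, h3⟩
      exact h3 _ (Finset.Subset.refl _) hJ h1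
    · rintro rfl
      exact ⟨Finset.Subset.refl _, hJ, fun K h1 _ h2 => Finset.Subset.antisymm h2 h1⟩
  rw [zc, this, Finset.sum_singleton, R_WJ hDU hdisj h1D hnD x y hp]
  simp

end

/-- every point satisfying the facet inequalities (indexed by proper
diagonals) satisfies all inequalities `∑_{i∈I} x_i ≥ z^c_I`; moreover
`z^c_{R_δ} = w_δ` for every proper diagonal `δ`, and the two halfspace
descriptions define the same subset. -/
theorem statement0 (n : ℕ) (D U : Finset ℕ) (hn : 2 ≤ n)
    (hDU : D ∪ U = Finset.Icc 1 n) (hdisj : Disjoint D U) (h1D : 1 ∈ D) (hnD : n ∈ D)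
    (w : ℕ × ℕ → ℝ) (zn : ℝ) :
    (∀ x : ℕ → ℝ, (∑ i ∈ Finset.Icc 1 n, x i) = zn →
        (∀ a b : ℕ, IsProper n D U a b → w (a, b) ≤ ∑ i ∈ Rdiag n D U a b, x i) →
        ∀ I : Finset ℕ, I ⊆ Finset.Icc 1 n → I.Nonempty →
          zc n D U w zn I ≤ ∑ i ∈ I, x i)
    ∧ (∀ a b : ℕ, IsProper n D U a b → zc n D U w zn (Rdiag n D U a b) = w (a, b))
    ∧ {x : ℕ → ℝ | (∑ i ∈ Finset.Icc 1 n, x i) = zn ∧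
          ∀ a b : ℕ, IsProper n D U a b → w (a, b) ≤ ∑ i ∈ Rdiag n D U a b, x i}
      = {x : ℕ → ℝ | (∑ i ∈ Finset.Icc 1 n, x i) = zn ∧
          ∀ I : Finset ℕ, I ⊆ Finset.Icc 1 n → I.Nonempty →
            zc n D U w zn I ≤ ∑ i ∈ I, x i} := by
  have P1 := fun (x : ℕ → ℝ) hx hw (I : Finset ℕ) (hI : I ⊆ Finset.Icc 1 n)
    (_ : I.Nonempty) => part1 hDU hdisj w zn x hx hw I hI
  have P2 := fun (a b : ℕ) hp => part2 hDU hdisj h1D hnD w zn a b hp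
  refine ⟨P1, P2, ?_⟩
  ext x
  constructor
  · rintro ⟨hx, hw⟩
    exact ⟨hx, P1 x hx hw⟩
  · rintro ⟨hx, hw⟩
    refine ⟨hx, fun a b hp => ?_⟩
    rw [← P2 a b hp]
    exact hw _ (Rdiag_subset hDU a b) (R_ab hDU hdisj h1D hnD a b hp).1

end AssocPaper
end

section
/- Let the right-hand sides be specialised to the associahedron As^c_{n−1}, i.e. w_δ = |R_δ|(|R_δ|+1)/2 for every proper diagonal δ and z_{[n]} = n(n+1)/2. Then for every nonempty I ⊆ [n]: if I is nested and I is not a one-element subset of U, then y_I = (−1)^{|I ∩ U|} · K_γ · K_Γ; if I = {u} for some u ∈ U, then y_I = (−1)^{|I ∩ U|} · ( K_γ·K_Γ − (n+1) ) = −( K_γ·K_Γ − (n+1) ); and if v(I) ≥ 2 then y_I = 0. -/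
open Finset

attribute [local instance] Classical.propDecidable

namespace AssocPaper

/-- The signed length `K_γ = |R_{δ_3}| − |R_{δ_1}|`. -/
noncomputable def Kgam (n : ℕ) (D U I : Finset ℕ) : ℤ :=
  ((Rext n D U (minEl I) (bI n D I)).card : ℤ) - ((Rext n D U (aI D I) (bI n D I)).card : ℤ)

/-- The signed length `K_Γ = |R_{δ_2}| − |R_{δ_1}|`. -/
noncomputable def KGam (n : ℕ) (D U I : Finset ℕ) : ℤ :=
  ((Rext n D U (aI D I) (maxEl I)).card : ℤ) - ((Rext n D U (aI D I) (bI n D I)).card : ℤ)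

/-- Pointwise form of the standing hypotheses. -/
structure Setup (n : ℕ) (D U : Finset ℕ) : Prop where
  hD : ∀ d ∈ D, 1 ≤ d ∧ d ≤ n
  hU : ∀ u ∈ U, 1 ≤ u ∧ u ≤ n
  hdis : ∀ d ∈ D, d ∉ U
  hall : ∀ i, 1 ≤ i → i ≤ n → i ∈ D ∨ i ∈ U
  h1 : 1 ∈ D
  hn : n ∈ D

theorem mem_Dbar {n : ℕ} {D : Finset ℕ} {x : ℕ} : x ∈ Dbar n D ↔ x = 0 ∨ x = n + 1 ∨ x ∈ D := by
  simp [Dbar]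

theorem aI_spec {n : ℕ} {D J : Finset ℕ} (hJ : J.Nonempty) (hsub : J ⊆ Icc 1 n) :
    (aI D J = 0 ∨ aI D J ∈ D) ∧ (∀ i ∈ J, aI D J < i) ∧ (∀ e ∈ D, (∀ i ∈ J, e < i) → e ≤ aI D J) := by
  have hne : ((insert 0 D).filter fun e => ∀ i ∈ J, e < i).Nonempty := by
    refine ⟨0, ?_⟩
    simp only [mem_filter, mem_insert, true_or, true_and]
    intro i hi
    have := mem_Icc.1 (hsub hi)
    omega
  obtain ⟨m, hm, hm2⟩ := Finset.exists_mem_eq_sup _ hne id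
  have h : aI D J = m := hm2
  rw [mem_filter, mem_insert] at hm
  refine ⟨h ▸ hm.1, h ▸ hm.2, fun e he h2 => ?_⟩
  exact Finset.le_sup (f := id) (mem_filter.2 ⟨mem_insert_of_mem he, h2⟩)

theorem bI_spec {n : ℕ} {D J : Finset ℕ} (hsub : J ⊆ Icc 1 n) :
    (bI n D J = n + 1 ∨ bI n D J ∈ D) ∧ (∀ i ∈ J, i < bI n D J) ∧
      (∀ e ∈ D, (∀ i ∈ J, i < e) → bI n D J ≤ e) ∧ bI n D J ≤ n + 1 := by
  have hne : (n + 1) ∈ {e : ℕ | e ∈ insert (n + 1) D ∧ ∀ i ∈ J, i < e} := by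
    refine ⟨mem_insert_self _ _, ?_⟩
    intro i hi
    have := mem_Icc.1 (hsub hi)
    omega
  have h := Nat.sInf_mem ⟨_, hne⟩
  refine ⟨mem_insert.1 h.1, h.2, fun e he h2 => ?_, Nat.sInf_le hne⟩
  exact Nat.sInf_le ⟨mem_insert_of_mem he, h2⟩

theorem minEl_spec {I : Finset ℕ} (hI : I.Nonempty) : minEl I ∈ I ∧ ∀ i ∈ I, minEl I ≤ i :=
  ⟨Nat.sInf_mem (s := {i : ℕ | i ∈ I}) hI, fun _ hi => Nat.sInf_le hi⟩

theorem maxEl_spec {I : Finset ℕ} (hI : I.Nonempty) : maxEl I ∈ I ∧ ∀ i ∈ I, i ≤ maxEl I := by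
  obtain ⟨m, hm, hm2⟩ := Finset.exists_mem_eq_sup _ hI id
  have h : maxEl I = m := hm2
  exact ⟨h ▸ hm, fun i hi => Finset.le_sup (f := id) hi⟩

/-- `(a,b)` are consecutive in `D̄ \ J`. -/
def Gap (D J : Finset ℕ) (a b : ℕ) : Prop :=
  a < b ∧ a ∉ J ∧ b ∉ J ∧ ∀ d ∈ D, a < d → d < b → d ∈ J

/-- Consecutive pairs of `{a} ∪ (J ∩ U ∩ (a,b)) ∪ {b}`. -/
def CPair (U J : Finset ℕ) (a b x y : ℕ) : Prop :=
  x < y ∧ (x = a ∨ (x ∈ J ∧ x ∈ U ∧ a < x ∧ x < b)) ∧ (y = b ∨ (y ∈ J ∧ y ∈ U ∧ a < y ∧ y < b)) ∧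
    ∀ u ∈ J, u ∈ U → ¬ (x < u ∧ u < y)

noncomputable def Afun (D U : Finset ℕ) (x : ℕ) : ℤ :=
  if x ∈ U then (D.card : ℤ) + (U.filter fun u => u ≤ x).card else (D.filter fun d => x < d).card

noncomputable def Bfun (D U : Finset ℕ) (y : ℕ) : ℤ :=
  if y ∈ U then ((U.filter fun u => y ≤ u).card : ℤ) else -((D.filter fun d => y ≤ d).card : ℤ)

theorem card_Rdiag {n : ℕ} {D U : Finset ℕ} (S : Setup n D U) {x y : ℕ} (hxy : x < y) :
    ((Rdiag n D U x y).card : ℤ) = Afun D U x + Bfun D U y := by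
  have hdis := S.hdis
  unfold Rdiag Afun Bfun
  split_ifs with h1 h2 h2
  · rw [card_union_of_disjoint, card_union_of_disjoint]
    · push_cast; ring
    · rw [Finset.disjoint_left]; intro i; simp only [mem_filter]; grind
    · rw [Finset.disjoint_left]; intro i; simp only [mem_filter, mem_union]; grind
  · rw [card_union_of_disjoint]
    · have := card_filter_add_card_filter_not (s := D) (fun d => d < y)
      simp only [not_lt] at this
      rw [← this]; push_cast; ring
    · rw [Finset.disjoint_left]; intro i; simp only [mem_filter]; grind
  · rw [card_union_of_disjoint]
    · push_cast; ring
    · rw [Finset.disjoint_left]; intro i; simp only [mem_filter]; grind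
  · have : D.filter (fun d => x < d) = D.filter (fun d => x < d ∧ d < y) ∪ D.filter fun d => y ≤ d := by
      ext i; simp only [mem_filter, mem_union]; grind
    rw [this, card_union_of_disjoint]
    · push_cast; ring
    · rw [Finset.disjoint_left]; intro i; simp only [mem_filter]; grind

theorem AB_D {n : ℕ} {D U : Finset ℕ} (S : Setup n D U) {d : ℕ} (hd : d ∈ D) :
    Afun D U d + Bfun D U d = -1 := by
  have h := S.hdis d hd
  unfold Afun Bfun
  rw [if_neg h, if_neg h]
  have : D.filter (fun e => d ≤ e) = insert d (D.filter (fun e => d < e)) := by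
    ext i; simp only [mem_filter, mem_insert]; grind
  rw [this, card_insert_of_notMem (by simp)]
  push_cast; ring

theorem card_DU {n : ℕ} {D U : Finset ℕ} (S : Setup n D U) : (D.card : ℤ) + U.card = n := by
  have h : D ∪ U = Icc 1 n := by
    ext i
    have h1 := S.hD i
    have h2 := S.hU i
    have h3 := S.hall i
    simp only [mem_union, mem_Icc]
    grind
  have h2 : Disjoint D U := Finset.disjoint_left.2 S.hdis
  have := card_union_of_disjoint h2
  rw [h] at this
  simp at this
  omega

theorem AB_U {n : ℕ} {D U : Finset ℕ} (S : Setup n D U) {u : ℕ} (hu : u ∈ U) :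
    Afun D U u + Bfun D U u = n + 1 := by
  unfold Afun Bfun
  rw [if_pos hu, if_pos hu]
  have : U.filter (fun e => u ≤ e) = insert u (U.filter (fun e => ¬ e ≤ u)) := by
    ext i; simp only [mem_filter, mem_insert]; grind
  rw [this, card_insert_of_notMem (by simp)]
  have h2 := card_filter_add_card_filter_not (s := U) (fun d => d ≤ u)
  have h3 := card_DU S
  push_cast
  omega

theorem Rdiag_boundary {n : ℕ} {D U : Finset ℕ} (S : Setup n D U) {x y : ℕ} (hxy : x < y)
    (hb : IsBoundary n D U x y) :
    (ConsecIn (Dbar n D) x y ∧ Rdiag n D U x y = ∅ ∧ x ∉ U ∧ y ∉ U ∧ ¬ (U = ∅ ∧ x = 0 ∧ y = n + 1)) ∨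
      (Rdiag n D U x y = Icc 1 n ∧ ((U = ∅ ∧ x = 0 ∧ y = n + 1) ∨ x ∈ U ∨ y ∈ U)) := by
  have hD := S.hD
  have hU := S.hU
  have hdis := S.hdis
  have hall := S.hall
  have hn1 := S.h1
  rcases hb with h | ⟨-, ⟨rfl, hy, hm⟩ | ⟨rfl, hx, hm⟩ | h⟩ | ⟨rfl, rfl, rfl⟩
  · left
    have hx := mem_Dbar.1 h.1
    have hy := mem_Dbar.1 h.2.1
    have hz := h.2.2.2
    simp only [mem_Dbar] at hz
    have hxU : x ∉ U := by grind
    have hyU : y ∉ U := by grind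
    refine ⟨h, ?_, hxU, hyU, ?_⟩
    · unfold Rdiag
      rw [if_neg hxU, if_neg hyU]
      ext i
      simp only [mem_filter, notMem_empty, iff_false]
      grind
    · rintro ⟨-, rfl, rfl⟩
      have := hD 1 hn1
      exact hz 1 (by tauto) (by omega)
  · right
    refine ⟨?_, by tauto⟩
    have h0 : 0 ∉ U := by grind
    unfold Rdiag
    rw [if_neg h0, if_pos hy]
    ext i
    simp only [mem_filter, mem_union, mem_Icc]
    grind
  · right
    refine ⟨?_, by tauto⟩
    have h0 : n + 1 ∉ U := by grind
    unfold Rdiag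
    rw [if_pos hx, if_neg h0]
    ext i
    simp only [mem_filter, mem_union, mem_Icc]
    grind
  · right
    obtain ⟨hx, hy, -, hz⟩ := h
    refine ⟨?_, by tauto⟩
    unfold Rdiag
    rw [if_pos hx, if_pos hy]
    ext i
    simp only [mem_filter, mem_union, mem_Icc]
    grind
  · right
    refine ⟨?_, by tauto⟩
    unfold Rdiag
    ext i
    simp
    grind

theorem Rext_eq {n : ℕ} {D U : Finset ℕ} (S : Setup n D U) {x y : ℕ} (hxy : x < y) (hy : y ≤ n + 1) :
    Rext n D U x y = Rdiag n D U x y := by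
  unfold Rext
  split_ifs with h1 h2 h3
  · rfl
  all_goals
    have hb : IsBoundary n D U x y := by
      by_contra h
      exact h1 ⟨hxy, hy, h⟩
    have := Rdiag_boundary S hxy hb
    grind

theorem Kgam_eq {n : ℕ} {D U I : Finset ℕ} (S : Setup n D U) (hne : I.Nonempty) (hsub : I ⊆ Icc 1 n) :
    Kgam n D U I = Afun D U (minEl I) - Afun D U (aI D I) := by
  obtain ⟨-, ha, -⟩ := aI_spec (D := D) hne hsub
  obtain ⟨-, hb, -, hb2⟩ := bI_spec (D := D) hsub
  obtain ⟨hm, -⟩ := minEl_spec hne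
  have h1 := ha _ hm
  have h2 := hb _ hm
  unfold Kgam
  rw [Rext_eq S h2 hb2, Rext_eq S (h1.trans h2) hb2, card_Rdiag S h2, card_Rdiag S (h1.trans h2)]
  ring

theorem KGam_eq {n : ℕ} {D U I : Finset ℕ} (S : Setup n D U) (hne : I.Nonempty) (hsub : I ⊆ Icc 1 n) :
    KGam n D U I = Bfun D U (maxEl I) - Bfun D U (bI n D I) := by
  obtain ⟨-, ha, -⟩ := aI_spec (D := D) hne hsub
  obtain ⟨-, hb, -, hb2⟩ := bI_spec (D := D) hsub
  obtain ⟨hm, -⟩ := maxEl_spec hne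
  have h1 := ha _ hm
  have h2 := hb _ hm
  unfold KGam
  rw [Rext_eq S h1 (by omega), Rext_eq S (h1.trans h2) hb2, card_Rdiag S h1, card_Rdiag S (h1.trans h2)]
  ring

theorem gap_nested {n : ℕ} {D U J : Finset ℕ} (S : Setup n D U) (hsub : J ⊆ Icc 1 n) {a b : ℕ}
    (ha : a ∈ Dbar n D) (hb : b ∈ Dbar n D) (hg : Gap D J a b)
    (hne : (J.filter fun i => a < i ∧ i < b).Nonempty) :
    aI D (J.filter fun i => a < i ∧ i < b) = a ∧ bI n D (J.filter fun i => a < i ∧ i < b) = b ∧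
      IsNested n D (J.filter fun i => a < i ∧ i < b) := by
  obtain ⟨hab, haJ, hbJ, hd⟩ := hg
  have hsub' : (J.filter fun i => a < i ∧ i < b) ⊆ Icc 1 n := (filter_subset _ _).trans hsub
  obtain ⟨a1, a2, a3⟩ := aI_spec (D := D) hne hsub'
  obtain ⟨b1, b2, b3, b4⟩ := bI_spec (D := D) hsub'
  have hD := S.hD
  rw [mem_Dbar] at ha hb
  obtain ⟨j, hj⟩ := hne
  have hj' := hj
  have hJ : ∀ i ∈ J, 1 ≤ i ∧ i ≤ n := fun i hi => mem_Icc.1 (hsub hi)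
  have a2j := a2 j hj
  have b2j := b2 j hj
  have hn1 := S.h1
  simp only [mem_filter] at a2 a3 b2 b3 hj
  set a' := aI D (J.filter fun i => a < i ∧ i < b)
  set b' := bI n D (J.filter fun i => a < i ∧ i < b)
  have e1 : a' = a := by
    apply le_antisymm
    · by_contra h
      have : a' ∈ D := by grind
      have := a2 a' ⟨hd a' this (by omega) (by omega), by omega, by omega⟩
      omega
    · by_contra h
      have : a ∈ D := by grind
      have := a3 a this (by grind)
      omega
  have e2 : b' = b := by
    apply le_antisymm
    · by_contra h
      have : b ∈ D := by grind
      have := b3 b this (by grind)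
      omega
    · by_contra h
      have : b' ∈ D := by grind
      have := b2 b' ⟨hd b' this (by omega) (by omega), by omega, by omega⟩
      omega
  refine ⟨e1, e2, ⟨j, hj'⟩, hsub', ?_⟩
  intro d hdD h1 h2
  change a' < d at h1
  change d < b' at h2
  rw [e1] at h1
  rw [e2] at h2
  simp only [mem_filter]
  exact ⟨hd d hdD h1 h2, h1, h2⟩

theorem nested_sub_gap {n : ℕ} {D U J K : Finset ℕ} (S : Setup n D U) {a b : ℕ}
    (ha : a ∈ Dbar n D) (hb : b ∈ Dbar n D) (hg : Gap D J a b) (hK : IsNested n D K) (hKJ : K ⊆ J)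
    {j : ℕ} (hj : j ∈ K) (h1 : a < j) (h2 : j < b) : K ⊆ J.filter fun i => a < i ∧ i < b := by
  obtain ⟨hab, haJ, hbJ, hd⟩ := hg
  obtain ⟨hne, hsub, hnest⟩ := hK
  obtain ⟨a1, a2, a3⟩ := aI_spec (D := D) hne hsub
  obtain ⟨b1, b2, b3, b4⟩ := bI_spec (D := D) hsub
  rw [mem_Dbar] at ha hb
  have hD := S.hD
  have a2j := a2 j hj
  have b2j := b2 j hj
  have e1 : a ≤ aI D K := by
    by_contra h
    have : a ∈ D := by grind
    exact haJ (hKJ (hnest a this (by omega) (by omega)))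
  have e2 : bI n D K ≤ b := by
    by_contra h
    have : b ∈ D := by grind
    exact hbJ (hKJ (hnest b this (by omega) (by omega)))
  intro i hi
  have := a2 i hi
  have := b2 i hi
  exact mem_filter.2 ⟨hKJ hi, by omega, by omega⟩

theorem exists_gap {n : ℕ} {D U J : Finset ℕ} (S : Setup n D U) (hsub : J ⊆ Icc 1 n) {j : ℕ}
    (hj : j ∈ J) : ∃ a ∈ Dbar n D, ∃ b ∈ Dbar n D, Gap D J a b ∧ a < j ∧ j < b := by
  have hj1 := mem_Icc.1 (hsub hj)
  have hD := S.hD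
  have h0 : 0 ∉ J := fun h => by have := mem_Icc.1 (hsub h); omega
  have h0' : n + 1 ∉ J := fun h => by have := mem_Icc.1 (hsub h); omega
  obtain ⟨a, ha, hamax⟩ := Finset.exists_max_image ((Dbar n D).filter fun e => e ∉ J ∧ e < j) id
    ⟨0, by simp [mem_Dbar, h0]; omega⟩
  obtain ⟨b, hb, hbmin⟩ := Finset.exists_min_image ((Dbar n D).filter fun e => e ∉ J ∧ j < e) id
    ⟨n + 1, by simp [mem_Dbar, h0']; omega⟩
  simp only [mem_filter, id, mem_Dbar] at *
  refine ⟨a, ha.1, b, hb.1, ⟨by omega, ha.2.1, hb.2.1, ?_⟩, ha.2.2, hb.2.2⟩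
  intro d hd h1 h2
  by_contra h
  rcases lt_trichotomy d j with h3 | rfl | h3
  · have := hamax d ⟨by tauto, h, h3⟩; omega
  · exact h hj
  · have := hbmin d ⟨by tauto, h, h3⟩; omega

theorem wAs_of_card {n : ℕ} {D U : Finset ℕ} {q : ℕ × ℕ} (h : Rdiag n D U q.1 q.2 = Icc 1 n) :
    wAs n D U q = znAs n := by
  unfold wAs znAs
  rw [h]
  simp

theorem component_value {n : ℕ} {D U J : Finset ℕ} (S : Setup n D U) (hsub : J ⊆ Icc 1 n) {a b : ℕ}
    (ha : a ∈ Dbar n D) (hb : b ∈ Dbar n D) (hg : Gap D J a b)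
    (hne : (J.filter fun i => a < i ∧ i < b).Nonempty) :
    ((∑ p ∈ WJ n D U (J.filter fun i => a < i ∧ i < b), wAs n D U p)
      - (((WJ n D U (J.filter fun i => a < i ∧ i < b)).card : ℝ) - 1) * znAs n)
    = znAs n + ∑ q ∈ range (n + 2) ×ˢ range (n + 2),
        if CPair U J a b q.1 q.2 then wAs n D U q - znAs n else 0 := by
  obtain ⟨e1, e2, e3⟩ := gap_nested S hsub ha hb hg hne
  obtain ⟨hab, haJ, hbJ, hd⟩ := hg
  have h1 : ((∑ p ∈ WJ n D U (J.filter fun i => a < i ∧ i < b), wAs n D U p)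
      - (((WJ n D U (J.filter fun i => a < i ∧ i < b)).card : ℝ) - 1) * znAs n)
      = znAs n + ∑ q ∈ WJ n D U (J.filter fun i => a < i ∧ i < b), (wAs n D U q - znAs n) := by
    rw [sum_sub_distrib, sum_const, nsmul_eq_mul]; ring
  rw [h1, ← sum_filter]
  congr 1
  have hdis := S.hdis
  have hD := S.hD
  have hU := S.hU
  have haU : a ∉ U := by rw [mem_Dbar] at ha; grind
  have hbU : b ∉ U := by rw [mem_Dbar] at hb; grind
  apply sum_subset
  · intro q
    simp only [WJ, mem_filter, AssocDiag, e1, e2, IsRunEnd, IsRunStart, CPair, mem_inter]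
    grind
  · intro q hq hq2
    rw [mem_filter] at hq
    obtain ⟨hr, hxy, hx, hy, hu⟩ := hq
    rw [mem_product, mem_range, mem_range] at hr
    by_cases hb' : IsBoundary n D U q.1 q.2
    · rcases Rdiag_boundary S hxy hb' with ⟨hc, hR, hxU, hyU, -⟩ | ⟨hR, -⟩
      · exfalso
        have hxa : q.1 = a := by grind
        have hyb : q.2 = b := by grind
        obtain ⟨j, hj⟩ := hne
        rw [mem_filter] at hj
        have hjn := mem_Icc.1 (hsub hj.1)
        rcases S.hall j hjn.1 hjn.2 with h | h
        · exact hc.2.2.2 j (mem_Dbar.2 (by tauto)) (by omega)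
        · exact hu j hj.1 h (by omega)
      · rw [wAs_of_card hR, sub_self]
    · exfalso
      apply hq2
      have hnc : ¬ ConsecIn U q.1 q.2 := by
        intro hc
        exact hb' (Or.inr (Or.inl ⟨⟨_, hc.1⟩, Or.inr (Or.inr hc)⟩))
      have key : ∀ y, ConsecIn U q.1 y → y ∈ J → y < b → False := by
        intro y hc hyJ hyb
        rcases hy with h | h
        · exact hu y hyJ hc.2.1 ⟨hc.2.2.1, by omega⟩
        · have k1 := hu y hyJ hc.2.1
          have k2 := hc.2.2.2 _ h.2.1
          have k3 := hc.2.2.1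
          have : y = q.2 := by omega
          exact hnc (this ▸ hc)
      have key2 : ∀ x, ConsecIn U x q.2 → x ∈ J → a < x → False := by
        intro x hc hxJ hxa
        rcases hx with h | h
        · exact hu x hxJ hc.1 ⟨by omega, hc.2.2.1⟩
        · have k1 := hu x hxJ hc.1
          have k2 := hc.2.2.2 _ h.2.1
          have k3 := hc.2.2.1
          have : x = q.1 := by omega
          exact hnc (this ▸ hc)
      simp only [WJ, mem_filter, AssocDiag, e1, e2, IsRunEnd, IsRunStart, mem_inter, mem_product,
        mem_range]
      refine ⟨hr, ⟨hxy, ?_, ?_, ?_⟩, hxy, by omega, hb'⟩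
      · rcases hx with h | h
        · exact Or.inl h
        · exact Or.inr ⟨⟨h.1, h.2.2⟩, h.2.1, fun y hc h2 => key y hc h2.1 h2.2.2⟩
      · rcases hy with h | h
        · exact Or.inl h
        · exact Or.inr ⟨⟨h.1, h.2.2⟩, h.2.1, fun y hc h2 => key2 y hc h2.1 h2.2.1⟩
      · intro u hu2
        exact hu u hu2.1.1 hu2.2

theorem component_empty {n : ℕ} {D U J : Finset ℕ} (S : Setup n D U) {a b : ℕ}
    (ha : a ∈ Dbar n D) (hb : b ∈ Dbar n D) (hg : Gap D J a b)
    (hne : ¬ (J.filter fun i => a < i ∧ i < b).Nonempty) :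
    znAs n + ∑ q ∈ range (n + 2) ×ˢ range (n + 2),
        (if CPair U J a b q.1 q.2 then wAs n D U q - znAs n else 0) = 0 := by
  obtain ⟨hab, haJ, hbJ, hd⟩ := hg
  have hD := S.hD
  have hU := S.hU
  have hdis := S.hdis
  rw [not_nonempty_iff_eq_empty, filter_eq_empty_iff] at hne
  have haU : a ∉ U := by rw [mem_Dbar] at ha; grind
  have hbU : b ∉ U := by rw [mem_Dbar] at hb; grind
  have hbn : b ≤ n + 1 := by rw [mem_Dbar] at hb; grind
  rw [sum_eq_single (a, b)]
  · have hc : CPair U J a b a b := ⟨hab, Or.inl rfl, Or.inl rfl, by grind⟩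
    rw [if_pos hc]
    have : Rdiag n D U a b = ∅ := by
      unfold Rdiag
      rw [if_neg haU, if_neg hbU, filter_eq_empty_iff]
      intro d hdD h
      exact hne (hd d hdD h.1 h.2) h
    simp [wAs, this]
  · rintro ⟨x, y⟩ - h
    rw [if_neg]
    rintro ⟨h1, h2, h3, h4⟩
    have hx : x = a := by grind
    have hy : y = b := by grind
    exact h (by simp [hx, hy])
  · intro h
    exfalso
    apply h
    simp only [mem_product, mem_range]
    omega

theorem zc_eq {n : ℕ} {D U J : Finset ℕ} (S : Setup n D U) (hsub : J ⊆ Icc 1 n) :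
    zc n D U (wAs n D U) (znAs n) J = ∑ p ∈ Dbar n D ×ˢ Dbar n D,
      if Gap D J p.1 p.2 then
        znAs n + ∑ q ∈ range (n + 2) ×ˢ range (n + 2),
          (if CPair U J p.1 p.2 q.1 q.2 then wAs n D U q - znAs n else 0) else 0 := by
  rw [← sum_filter]
  have h1 : ∑ p ∈ (Dbar n D ×ˢ Dbar n D).filter (fun p => Gap D J p.1 p.2),
      (znAs n + ∑ q ∈ range (n + 2) ×ˢ range (n + 2),
          (if CPair U J p.1 p.2 q.1 q.2 then wAs n D U q - znAs n else 0))
    = ∑ p ∈ ((Dbar n D ×ˢ Dbar n D).filter (fun p => Gap D J p.1 p.2)).filter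
        (fun p => (J.filter fun i => p.1 < i ∧ i < p.2).Nonempty),
      (znAs n + ∑ q ∈ range (n + 2) ×ˢ range (n + 2),
          (if CPair U J p.1 p.2 q.1 q.2 then wAs n D U q - znAs n else 0)) := by
    symm
    apply sum_filter_of_ne
    intro p hp h
    by_contra hne
    rw [mem_filter, mem_product] at hp
    exact h (component_empty S hp.1.1 hp.1.2 hp.2 hne)
  rw [h1]
  unfold zc
  symm
  apply sum_nbij (fun p => J.filter fun i => p.1 < i ∧ i < p.2)
  · intro p hp
    simp only [mem_filter, mem_product] at hp
    obtain ⟨⟨⟨ha, hb⟩, hg⟩, hne⟩ := hp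
    obtain ⟨e1, e2, e3⟩ := gap_nested S hsub ha hb hg hne
    simp only [nestedComponents, mem_filter, mem_powerset]
    refine ⟨filter_subset _ _, e3, ?_⟩
    intro K hK hKn hsubK
    apply subset_antisymm hsubK
    obtain ⟨j, hj⟩ := hne
    have hj2 := mem_filter.1 hj
    exact nested_sub_gap S ha hb hg hKn hK (hsubK hj) hj2.2.1 hj2.2.2
  · intro p hp p' hp' h
    simp only [coe_filter, mem_filter, mem_product, Set.mem_setOf_eq] at hp hp'
    obtain ⟨⟨⟨ha, hb⟩, hg⟩, hne⟩ := hp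
    obtain ⟨⟨⟨ha', hb'⟩, hg'⟩, hne'⟩ := hp'
    obtain ⟨e1, e2, e3⟩ := gap_nested S hsub ha hb hg hne
    obtain ⟨e1', e2', e3'⟩ := gap_nested S hsub ha' hb' hg' hne'
    simp only at h
    rw [h] at e1 e2
    exact Prod.ext (e1.symm.trans e1') (e2.symm.trans e2')
  · intro K hK
    simp only [nestedComponents, coe_filter, mem_powerset, Set.mem_setOf_eq] at hK
    obtain ⟨hKJ, hKn, hmax⟩ := hK
    obtain ⟨j, hj⟩ := hKn.1
    obtain ⟨a, ha, b, hb, hg, h1, h2⟩ := exists_gap S hsub (hKJ hj)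
    have hs := nested_sub_gap S ha hb hg hKn hKJ hj h1 h2
    have hne : (J.filter fun i => a < i ∧ i < b).Nonempty := ⟨j, hs hj⟩
    refine ⟨(a, b), ?_, ?_⟩
    · simp only [coe_filter, mem_filter, mem_product, Set.mem_setOf_eq]
      exact ⟨⟨⟨ha, hb⟩, hg⟩, hne⟩
    · exact (hmax _ (filter_subset _ _) (gap_nested S hsub ha hb hg hne).2.2 hs).symm
  · intro p hp
    simp only [mem_filter, mem_product] at hp
    obtain ⟨⟨⟨ha, hb⟩, hg⟩, hne⟩ := hp
    exact (component_value S hsub ha hb hg hne).symm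

/-- Moebius inversion of an interval indicator. -/
noncomputable def Mob (I P Q : Finset ℕ) : ℝ :=
  if P ⊆ I ∧ I ⊆ P ∪ Q then (-1 : ℝ) ^ (I \ P).card else 0

theorem mobius {I P Q : Finset ℕ} (hPQ : Disjoint P Q) :
    ∑ J ∈ I.powerset, (-1 : ℝ) ^ (I \ J).card * (if P ⊆ J ∧ Disjoint Q J then 1 else 0) = Mob I P Q := by
  unfold Mob
  by_cases hP : P ⊆ I
  · by_cases hI : I ⊆ P ∪ Q
    · rw [if_pos ⟨hP, hI⟩, sum_eq_single P]
      · rw [if_pos ⟨subset_rfl, hPQ.symm⟩, mul_one]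
      · intro J hJ hne
        rw [if_neg, mul_zero]
        rintro ⟨h1, h2⟩
        apply hne
        apply subset_antisymm _ h1
        intro i hi
        have := hI (mem_powerset.1 hJ hi)
        have := Finset.disjoint_right.1 h2 hi
        grind
      · intro h; exact absurd (mem_powerset.2 hP) h
    · rw [if_neg (by tauto)]
      obtain ⟨e, heI, he⟩ := Finset.not_subset.1 hI
      rw [mem_union, not_or] at he
      apply sum_involution (fun J _ => if e ∈ J then J.erase e else insert e J)
      · intro J hJ
        have hJI := mem_powerset.1 hJ
        by_cases h1 : e ∈ J
        · have k1 : I \ J.erase e = insert e (I \ J) := by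
            ext i; simp only [mem_sdiff, mem_erase, mem_insert]; grind
          have k2 : (P ⊆ J.erase e ∧ Disjoint Q (J.erase e)) ↔ (P ⊆ J ∧ Disjoint Q J) := by
            simp only [Finset.disjoint_left, Finset.subset_iff, mem_erase]; grind
          simp only [if_pos h1, k2]
          rw [k1, card_insert_of_notMem (by simp [h1]), pow_succ]; ring
        · have k1 : I \ J = insert e (I \ insert e J) := by
            ext i; simp only [mem_sdiff, mem_insert]; grind
          have k2 : (P ⊆ insert e J ∧ Disjoint Q (insert e J)) ↔ (P ⊆ J ∧ Disjoint Q J) := by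
            simp only [Finset.disjoint_left, Finset.subset_iff, mem_insert]; grind
          simp only [if_neg h1, k2]
          rw [k1, card_insert_of_notMem (by simp), pow_succ]; ring
      · intro J hJ _
        split_ifs with h1
        · intro h; rw [← h] at h1; simp at h1
        · intro h; rw [← h] at h1; simp at h1
      · intro J hJ
        by_cases h1 : e ∈ J
        · simp [h1, insert_erase h1]
        · simp [h1, erase_insert h1]
      · intro J hJ
        have hJI := mem_powerset.1 hJ
        rw [mem_powerset]
        split_ifs with h1
        · exact (erase_subset _ _).trans hJI
        · exact insert_subset heI hJI
  · rw [if_neg (by tauto)]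
    apply sum_eq_zero
    intro J hJ
    rw [if_neg, mul_zero]
    rintro ⟨h1, h2⟩
    exact hP (h1.trans (mem_powerset.1 hJ))

/-- Static part of the condition on `(x,y)`. -/
def Stat (U : Finset ℕ) (a b x y : ℕ) : Prop :=
  x < y ∧ (x = a ∨ (x ∈ U ∧ a < x ∧ x < b)) ∧ (y = b ∨ (y ∈ U ∧ a < y ∧ y < b))

noncomputable def P0 (D : Finset ℕ) (a b : ℕ) : Finset ℕ := D.filter fun d => a < d ∧ d < b

noncomputable def P1 (D U : Finset ℕ) (a b x y : ℕ) : Finset ℕ :=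
  P0 D a b ∪ U.filter fun u => u = x ∨ u = y

noncomputable def Q1 (U : Finset ℕ) (a b x y : ℕ) : Finset ℕ :=
  insert a (insert b (U.filter fun u => x < u ∧ u < y))

noncomputable def Yab (n : ℕ) (D U I : Finset ℕ) (a b : ℕ) : ℝ :=
  znAs n * Mob I (P0 D a b) {a, b} + ∑ q ∈ range (n + 2) ×ˢ range (n + 2),
    if Stat U a b q.1 q.2 then
      (wAs n D U q - znAs n) * Mob I (P1 D U a b q.1 q.2) (Q1 U a b q.1 q.2) else 0

theorem yI_eq {n : ℕ} {D U I : Finset ℕ} (S : Setup n D U) (hsub : I ⊆ Icc 1 n) :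
    yI n D U (wAs n D U) (znAs n) I = ∑ p ∈ Dbar n D ×ˢ Dbar n D,
      if p.1 < p.2 then Yab n D U I p.1 p.2 else 0 := by
  unfold yI
  have h1 : ∀ J ∈ I.powerset, (-1 : ℝ) ^ (I \ J).card * zc n D U (wAs n D U) (znAs n) J
      = ∑ p ∈ Dbar n D ×ˢ Dbar n D, (-1 : ℝ) ^ (I \ J).card * (if Gap D J p.1 p.2 then
        znAs n + ∑ q ∈ range (n + 2) ×ˢ range (n + 2),
          (if CPair U J p.1 p.2 q.1 q.2 then wAs n D U q - znAs n else 0) else 0) := by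
    intro J hJ
    rw [zc_eq S ((mem_powerset.1 hJ).trans hsub), mul_sum]
  rw [sum_congr rfl h1, sum_comm]
  apply sum_congr rfl
  rintro ⟨a, b⟩ hp
  rw [mem_product] at hp
  obtain ⟨ha, hb⟩ := hp
  simp only at ha hb ⊢
  have hD := S.hD
  have hU := S.hU
  have hdis := S.hdis
  have haU : a ∉ U := by rw [mem_Dbar] at ha; grind
  have hbU : b ∉ U := by rw [mem_Dbar] at hb; grind
  split_ifs with hab
  swap
  · apply sum_eq_zero
    intro J _
    rw [if_neg, mul_zero]
    intro h; exact hab h.1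
  unfold Yab
  have hg : ∀ J, Gap D J a b ↔ (P0 D a b ⊆ J ∧ Disjoint {a, b} J) := by
    intro J
    simp only [Gap, P0, Finset.subset_iff, mem_filter, disjoint_insert_left, disjoint_singleton_left]
    grind
  have hg2 : ∀ J x y, (Gap D J a b ∧ CPair U J a b x y) ↔
      (Stat U a b x y ∧ (P1 D U a b x y ⊆ J ∧ Disjoint (Q1 U a b x y) J)) := by
    intro J x y
    simp only [Gap, CPair, Stat, P1, Q1, P0, Finset.subset_iff, mem_filter, mem_union,
      Finset.disjoint_left, mem_insert]
    constructor
    · rintro ⟨⟨g1, g2, g3, g4⟩, c1, c2, c3, c4⟩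
      refine ⟨⟨c1, by tauto, by tauto⟩, ?_, ?_⟩ <;> grind
    · rintro ⟨⟨s1, s2, s3⟩, c1, c2⟩
      refine ⟨⟨hab, ?_, ?_, ?_⟩, s1, ?_, ?_, ?_⟩ <;> grind
  have h2 : ∀ J ∈ I.powerset, (-1 : ℝ) ^ (I \ J).card * (if Gap D J a b then
        znAs n + ∑ q ∈ range (n + 2) ×ˢ range (n + 2),
          (if CPair U J a b q.1 q.2 then wAs n D U q - znAs n else 0) else 0)
      = znAs n * ((-1 : ℝ) ^ (I \ J).card * (if P0 D a b ⊆ J ∧ Disjoint {a, b} J then 1 else 0))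
        + ∑ q ∈ range (n + 2) ×ˢ range (n + 2), if Stat U a b q.1 q.2 then (wAs n D U q - znAs n) *
          ((-1 : ℝ) ^ (I \ J).card * (if P1 D U a b q.1 q.2 ⊆ J ∧ Disjoint (Q1 U a b q.1 q.2) J
            then 1 else 0)) else 0 := by
    intro J _
    by_cases hG : Gap D J a b
    · rw [if_pos hG, if_pos ((hg J).1 hG), mul_add, mul_sum]
      congr 1
      · ring
      · apply sum_congr rfl
        intro q _
        have := hg2 J q.1 q.2
        by_cases hs : Stat U a b q.1 q.2
        · rw [if_pos hs]
          simp only [hG, hs, true_and] at this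
          simp only [this]
          split_ifs <;> ring
        · rw [if_neg hs, if_neg (by tauto), mul_zero]
    · rw [if_neg hG, if_neg (fun h => hG ((hg J).2 h))]
      rw [sum_eq_zero]
      · ring
      · intro q _
        have := hg2 J q.1 q.2
        split_ifs <;> first | rfl | (exfalso; tauto) | simp
  rw [sum_congr rfl h2, sum_add_distrib, ← mul_sum, mobius, sum_comm]
  · congr 1
    apply sum_congr rfl
    intro q _
    split_ifs with hs
    · rw [← mul_sum, mobius]
      rw [Finset.disjoint_left]
      simp only [Stat] at hs
      simp only [P1, Q1, P0, mem_filter, mem_union, mem_insert]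
      grind
    · simp
  · rw [Finset.disjoint_left]
    simp only [P0, mem_filter, mem_insert, mem_singleton]
    grind

/-- The condition under which `Yab` may be nonzero. -/
def Cond (D U I : Finset ℕ) (a b : ℕ) : Prop :=
  (∀ d ∈ D, a < d → d < b → d ∈ I) ∧ (∀ d ∈ I, d ∈ D → a ≤ d ∧ d ≤ b) ∧
    (∀ u ∈ I, u ∈ U → a < u ∧ u < b)

theorem Yab_zero {n : ℕ} {D U I : Finset ℕ} (S : Setup n D U) {a b : ℕ}
    (ha : a ∈ Dbar n D) (hb : b ∈ Dbar n D) (hab : a < b) (hc : ¬ Cond D U I a b) :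
    Yab n D U I a b = 0 := by
  have hD := S.hD
  have hU := S.hU
  have hdis := S.hdis
  have haU : a ∉ U := by rw [mem_Dbar] at ha; grind
  have hbU : b ∉ U := by rw [mem_Dbar] at hb; grind
  have h1 : Mob I (P0 D a b) {a, b} = 0 := by
    unfold Mob
    rw [if_neg]
    rintro ⟨h1, h2⟩
    apply hc
    simp only [P0, Finset.subset_iff, mem_filter, mem_union, mem_insert, mem_singleton] at h1 h2
    refine ⟨?_, ?_, ?_⟩ <;> grind
  unfold Yab
  rw [h1, mul_zero, zero_add]
  apply sum_eq_zero
  rintro ⟨x, y⟩ _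
  split_ifs with hs
  · have h2 : Mob I (P1 D U a b x y) (Q1 U a b x y) = 0 := by
      unfold Mob
      rw [if_neg]
      rintro ⟨h1, h2⟩
      apply hc
      simp only [P1, Q1, P0, Finset.subset_iff, mem_filter, mem_union, mem_insert] at h1 h2
      simp only [Stat] at hs
      refine ⟨?_, ?_, ?_⟩ <;> grind
    simp only
    rw [h2, mul_zero]
  · rfl

/-- Sign attached to an element. -/
noncomputable def sg (T : Finset ℕ) (a : ℕ) : ℝ := if a ∈ T then -1 else 1

theorem card_filter_eq_ite (T : Finset ℕ) (a : ℕ) :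
    (T.filter fun i => i = a).card = if a ∈ T then 1 else 0 := by
  rw [Finset.filter_eq']
  split_ifs <;> simp

theorem sign_P1 {n : ℕ} {D U I : Finset ℕ} (S : Setup n D U) (hsub : I ⊆ Icc 1 n) {a b x y : ℕ}
    (ha : a ∈ Dbar n D) (hb : b ∈ Dbar n D) (hab : a < b) (hc : Cond D U I a b) (hxy : x < y)
    (hP : P1 D U a b x y ⊆ I) :
    (-1 : ℝ) ^ (I \ P1 D U a b x y).card
      = sg I a * sg I b * (-1 : ℝ) ^ (I ∩ U).card * (sg U x * sg U y) := by
  have hD := S.hD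
  have hU := S.hU
  have hdis := S.hdis
  have haU : a ∉ U := by rw [mem_Dbar] at ha; grind
  have hbU : b ∉ U := by rw [mem_Dbar] at hb; grind
  obtain ⟨c1, c2, c3⟩ := hc
  have e1 : I.card = (P0 D a b).card + (I.filter fun i => i = a).card
      + (I.filter fun i => i = b).card + (I ∩ U).card := by
    rw [← card_union_of_disjoint, ← card_union_of_disjoint, ← card_union_of_disjoint]
    · congr 1
      ext i
      have hall := S.hall i
      have hi : i ∈ I → 1 ≤ i ∧ i ≤ n := fun h => mem_Icc.1 (hsub h)
      simp only [P0, mem_union, mem_filter, mem_inter]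
      grind
    all_goals
      rw [Finset.disjoint_left]
      intro i
      simp only [P0, mem_union, mem_filter, mem_inter]
      grind
  have e2 : (P1 D U a b x y).card = (P0 D a b).card + (U.filter fun i => i = x).card
      + (U.filter fun i => i = y).card := by
    rw [← card_union_of_disjoint, ← card_union_of_disjoint]
    · congr 1
      ext i
      simp only [P1, mem_union, mem_filter]
      grind
    all_goals
      rw [Finset.disjoint_left]
      intro i
      simp only [P0, mem_union, mem_filter]
      grind
  have e3 := card_sdiff_add_card_eq_card hP
  rw [e1, e2, card_filter_eq_ite, card_filter_eq_ite, card_filter_eq_ite, card_filter_eq_ite] at e3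
  have e4 : (I \ P1 D U a b x y).card + ((if x ∈ U then 1 else 0) + (if y ∈ U then 1 else 0))
      = (if a ∈ I then 1 else 0) + (if b ∈ I then 1 else 0) + (I ∩ U).card := by omega
  have e5 := congrArg (fun m => (-1 : ℝ) ^ m) e4
  simp only [pow_add] at e5
  unfold sg
  split_ifs at e5 ⊢ <;> simp at e5 ⊢ <;> linarith

theorem wAs_eq {n : ℕ} {D U : Finset ℕ} (S : Setup n D U) {x y : ℕ} (hxy : x < y) :
    wAs n D U (x, y) = ((Afun D U x : ℝ) + Bfun D U y) * ((Afun D U x : ℝ) + Bfun D U y + 1) / 2 := by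
  have h := card_Rdiag S hxy
  have h2 : ((Rdiag n D U x y).card : ℝ) = (Afun D U x : ℝ) + Bfun D U y := by exact_mod_cast h
  unfold wAs
  simp only
  rw [h2]

theorem Yab_empty {n : ℕ} {D U I : Finset ℕ} (S : Setup n D U) (hsub : I ⊆ Icc 1 n) {a b : ℕ}
    (ha : a ∈ Dbar n D) (hb : b ∈ Dbar n D) (hab : a < b) (hc : Cond D U I a b)
    (hS : ∀ i ∈ I, i ∉ U) :
    Yab n D U I a b = sg I a * sg I b * wAs n D U (a, b) := by
  have hD := S.hD
  have hU := S.hU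
  have hdis := S.hdis
  have haU : a ∉ U := by rw [mem_Dbar] at ha; grind
  have hbU : b ∉ U := by rw [mem_Dbar] at hb; grind
  have hbn : b ≤ n + 1 := by rw [mem_Dbar] at hb; grind
  have hall : ∀ i ∈ I, i ∈ D ∨ i ∈ U := fun i hi => S.hall i (mem_Icc.1 (hsub hi)).1 (mem_Icc.1 (hsub hi)).2
  have hIU : I ∩ U = ∅ := by ext i; simp only [mem_inter, notMem_empty]; grind
  have hc' := hc
  obtain ⟨c1, c2, c3⟩ := hc
  have hPP : P1 D U a b a b = P0 D a b := by
    ext i; simp only [P1, mem_union, mem_filter]; grind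
  have hP0 : P0 D a b ⊆ I := by
    intro i; simp only [P0, mem_filter]; grind
  have hsgn := sign_P1 (x := a) (y := b) S hsub ha hb hab hc' hab (hPP ▸ hP0)
  have hsx : sg U a = 1 := if_neg haU
  have hsy : sg U b = 1 := if_neg hbU
  rw [hPP, hIU, card_empty, pow_zero, hsx, hsy, mul_one, mul_one, mul_one] at hsgn
  have m1 : Mob I (P0 D a b) {a, b} = sg I a * sg I b := by
    unfold Mob
    rw [if_pos, hsgn]
    refine ⟨hP0, ?_⟩
    intro i hi
    simp only [P0, mem_filter, mem_union, mem_insert, mem_singleton]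
    grind
  have m2 : Mob I (P1 D U a b a b) (Q1 U a b a b) = sg I a * sg I b := by
    unfold Mob
    rw [hPP, if_pos, hsgn]
    refine ⟨hP0, ?_⟩
    intro i hi
    simp only [P0, Q1, mem_filter, mem_union, mem_insert]
    grind
  unfold Yab
  rw [sum_eq_single (a, b)]
  · have hs : Stat U a b a b := ⟨hab, Or.inl rfl, Or.inl rfl⟩
    simp only
    rw [if_pos hs, m1, m2]
    ring
  · rintro ⟨x, y⟩ - hne
    split_ifs with hs
    · simp only at hs ⊢
      unfold Mob
      rw [if_neg, mul_zero]
      rintro ⟨h1, h2⟩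
      apply hne
      simp only [P1, Finset.subset_iff, mem_union, mem_filter] at h1
      have k1 : x ∉ U := fun h => hS x (h1 (Or.inr ⟨h, Or.inl rfl⟩)) h
      have k2 : y ∉ U := fun h => hS y (h1 (Or.inr ⟨h, Or.inr rfl⟩)) h
      obtain ⟨s1, s2, s3⟩ := hs
      have : x = a := by tauto
      have : y = b := by tauto
      simp [*]
    · rfl
  · intro h
    exfalso
    apply h
    simp only [mem_product, mem_range]
    omega

set_option maxHeartbeats 2000000 in
theorem Yab_nonempty {n : ℕ} {D U I : Finset ℕ} (S : Setup n D U) (hsub : I ⊆ Icc 1 n) {a b s t : ℕ}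
    (ha : a ∈ Dbar n D) (hb : b ∈ Dbar n D) (hab : a < b) (hc : Cond D U I a b)
    (hsI : s ∈ I) (hsU : s ∈ U) (htI : t ∈ I) (htU : t ∈ U) (hmin : ∀ i ∈ I, i ∈ U → s ≤ i ∧ i ≤ t) :
    Yab n D U I a b = sg I a * sg I b * (-1 : ℝ) ^ (I ∩ U).card *
      (((Afun D U s : ℝ) - Afun D U a) * ((Bfun D U t : ℝ) - Bfun D U b)
        - if s = t then (n : ℝ) + 1 else 0) := by
  have hD := S.hD
  have hU := S.hU
  have hdis := S.hdis
  have haU : a ∉ U := by rw [mem_Dbar] at ha; grind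
  have hbU : b ∉ U := by rw [mem_Dbar] at hb; grind
  have hbn : b ≤ n + 1 := by rw [mem_Dbar] at hb; grind
  have hall : ∀ i ∈ I, i ∈ D ∨ i ∈ U := fun i hi => S.hall i (mem_Icc.1 (hsub hi)).1 (mem_Icc.1 (hsub hi)).2
  have hc' := hc
  obtain ⟨c1, c2, c3⟩ := hc
  have hs3 := c3 s hsI hsU
  have ht3 := c3 t htI htU
  have hst := (hmin s hsI hsU).2
  have m1 : Mob I (P0 D a b) {a, b} = 0 := by
    unfold Mob
    rw [if_neg]
    rintro ⟨h1, h2⟩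
    have := h2 hsI
    simp only [P0, mem_filter, mem_union, mem_insert, mem_singleton] at this
    grind
  have m2 : ∀ x y, (x = a ∨ x = s) → (y = b ∨ y = t) → x < y →
      Mob I (P1 D U a b x y) (Q1 U a b x y)
        = sg I a * sg I b * (-1 : ℝ) ^ (I ∩ U).card * (sg U x * sg U y) := by
    intro x y hx hy hxy
    have hP : P1 D U a b x y ⊆ I := by
      intro i
      simp only [P1, P0, mem_union, mem_filter]
      grind
    unfold Mob
    rw [if_pos, sign_P1 S hsub ha hb hab hc' hxy hP]
    refine ⟨hP, ?_⟩
    intro i hi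
    have i1 := hall i hi
    have i2 := hmin i hi
    have i3 := c2 i hi
    simp only [P1, Q1, P0, mem_filter, mem_union, mem_insert]
    grind
  unfold Yab
  rw [m1, mul_zero, zero_add]
  have hset : ({a, s} ×ˢ {b, t} : Finset (ℕ × ℕ)) ⊆ range (n + 2) ×ˢ range (n + 2) := by
    rintro ⟨x, y⟩
    simp only [mem_product, mem_insert, mem_singleton, mem_range]
    omega
  rw [← sum_subset hset]
  · have e1 : ∀ q ∈ ({a, s} ×ˢ {b, t} : Finset (ℕ × ℕ)),
        (if Stat U a b q.1 q.2 then
          (wAs n D U q - znAs n) * Mob I (P1 D U a b q.1 q.2) (Q1 U a b q.1 q.2) else 0)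
        = if q.1 < q.2 then (wAs n D U q - znAs n) *
          (sg I a * sg I b * (-1 : ℝ) ^ (I ∩ U).card * (sg U q.1 * sg U q.2)) else 0 := by
      rintro ⟨x, y⟩ hq
      simp only [mem_product, mem_insert, mem_singleton] at hq ⊢
      by_cases hxy : x < y
      · have hs : Stat U a b x y := by
          refine ⟨hxy, ?_, ?_⟩ <;> grind
        rw [if_pos hs, if_pos hxy, m2 x y hq.1 hq.2 hxy]
      · rw [if_neg hxy, if_neg (fun h => hxy h.1)]
    rw [sum_congr rfl e1, sum_product, sum_pair (by omega), sum_pair (by omega), sum_pair (by omega)]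
    have g1 : sg U a = 1 := if_neg haU
    have g2 : sg U b = 1 := if_neg hbU
    have g3 : sg U s = -1 := if_pos hsU
    have g4 : sg U t = -1 := if_pos htU
    simp only
    rw [g1, g2, g3, g4, if_pos hab, if_pos ht3.1, if_pos hs3.2, wAs_eq S hab, wAs_eq S ht3.1,
      wAs_eq S hs3.2]
    by_cases h : s = t
    · subst h
      have h5 := AB_U S hsU
      have h6 : (Bfun D U s : ℝ) = n + 1 - Afun D U s := by
        have : ((Afun D U s : ℝ) + Bfun D U s) = n + 1 := by exact_mod_cast h5
        linarith
      rw [if_neg (lt_irrefl _), if_pos rfl, h6]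
      unfold znAs
      ring
    · rw [if_pos (by omega), if_neg h, wAs_eq S (by omega)]
      ring
  · rintro ⟨x, y⟩ - hq
    split_ifs with hs
    · simp only at hs ⊢
      unfold Mob
      rw [if_neg, mul_zero]
      rintro ⟨h1, h2⟩
      apply hq
      obtain ⟨s1, s2, s3⟩ := hs
      have k1 := h2 hsI
      have k2 := h2 htI
      simp only [P1, P0, Q1, Finset.subset_iff, mem_union, mem_filter, mem_insert] at h1 k1 k2
      have k3 : x ∈ U → s ≤ x ∧ x ≤ t := fun h => hmin x (h1 (Or.inr ⟨h, Or.inl rfl⟩)) h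
      have k4 : y ∈ U → s ≤ y ∧ y ≤ t := fun h => hmin y (h1 (Or.inr ⟨h, Or.inr rfl⟩)) h
      simp only [mem_product, mem_insert, mem_singleton]
      grind
    · rfl

theorem Cond_nested {n : ℕ} {D U I : Finset ℕ} (S : Setup n D U) (hne : I.Nonempty)
    (hsub : I ⊆ Icc 1 n) {a b : ℕ} (hc : Cond D U I a b) : IsNested n D I := by
  obtain ⟨a1, a2, a3⟩ := aI_spec (D := D) hne hsub
  obtain ⟨b1, b2, b3, b4⟩ := bI_spec (D := D) hsub
  obtain ⟨c1, c2, c3⟩ := hc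
  have hall : ∀ i ∈ I, i ∈ D ∨ i ∈ U := fun i hi => S.hall i (mem_Icc.1 (hsub hi)).1 (mem_Icc.1 (hsub hi)).2
  have hle : ∀ i ∈ I, a ≤ i ∧ i ≤ b := by grind
  refine ⟨hne, hsub, fun d hd h1 h2 => ?_⟩
  by_contra hdI
  have k1 : ∃ i ∈ I, i ≤ d := by
    by_contra h
    push Not at h
    have := a3 d hd h
    omega
  have k2 : ∃ i ∈ I, d ≤ i := by
    by_contra h
    push Not at h
    have := b3 d hd h
    omega
  obtain ⟨i, hi, hid⟩ := k1
  obtain ⟨j, hj, hjd⟩ := k2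
  have i1 : i ≠ d := fun h => hdI (h ▸ hi)
  have j1 : j ≠ d := fun h => hdI (h ▸ hj)
  have := hle i hi
  have := hle j hj
  exact hdI (c1 d hd (by omega) (by omega))

theorem yI_nonnested {n : ℕ} {D U I : Finset ℕ} (S : Setup n D U) (hne : I.Nonempty)
    (hsub : I ⊆ Icc 1 n) (h : ¬ IsNested n D I) : yI n D U (wAs n D U) (znAs n) I = 0 := by
  rw [yI_eq S hsub]
  apply sum_eq_zero
  rintro ⟨a, b⟩ hp
  rw [mem_product] at hp
  split_ifs with hab
  · exact Yab_zero S hp.1 hp.2 hab (fun hc => h (Cond_nested S hne hsub hc))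
  · rfl

theorem nested_of_vI {n : ℕ} {D I : Finset ℕ} (h : 2 ≤ vI n D I) : ¬ IsNested n D I := by
  intro hn
  have : nestedComponents n D I ⊆ {I} := by
    intro J hJ
    simp only [nestedComponents, mem_filter, mem_powerset] at hJ
    rw [mem_singleton]
    exact hJ.2.2 I subset_rfl hn hJ.1
  have := card_le_card this
  simp only [card_singleton] at this
  unfold vI at h
  omega

theorem singleton_nested_s2 {n : ℕ} {D U : Finset ℕ} (S : Setup n D U) {u : ℕ} (hu : u ∈ U) :
    IsNested n D {u} := by
  have hsub : ({u} : Finset ℕ) ⊆ Icc 1 n := by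
    rw [singleton_subset_iff, mem_Icc]; exact S.hU u hu
  obtain ⟨a1, a2, a3⟩ := aI_spec (D := D) (singleton_nonempty u) hsub
  obtain ⟨b1, b2, b3, b4⟩ := bI_spec (D := D) hsub
  refine ⟨singleton_nonempty u, hsub, fun d hd h1 h2 => ?_⟩
  simp only [mem_singleton, forall_eq] at *
  by_contra hne
  rcases lt_or_gt_of_ne hne with h | h
  · have := a3 d hd h; omega
  · have := b3 d hd h; omega

set_option maxHeartbeats 2000000 in
theorem yI_nested {n : ℕ} {D U I : Finset ℕ} (S : Setup n D U) (hN : IsNested n D I) :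
    yI n D U (wAs n D U) (znAs n) I = (-1 : ℝ) ^ (I ∩ U).card *
      ((Kgam n D U I : ℝ) * KGam n D U I - if ∃ u ∈ U, I = {u} then (n : ℝ) + 1 else 0) := by
  obtain ⟨hne, hsub, hnest⟩ := hN
  obtain ⟨a1, a2, a3⟩ := aI_spec (D := D) hne hsub
  obtain ⟨b1, b2, b3, b4⟩ := bI_spec (D := D) hsub
  obtain ⟨g1, g2⟩ := minEl_spec hne
  obtain ⟨G1, G2⟩ := maxEl_spec hne
  have hD := S.hD
  have hU := S.hU
  have hdis := S.hdis
  have hall : ∀ i ∈ I, i ∈ D ∨ i ∈ U := fun i hi => S.hall i (mem_Icc.1 (hsub hi)).1 (mem_Icc.1 (hsub hi)).2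
  rw [Kgam_eq S hne hsub, KGam_eq S hne hsub, yI_eq S hsub]
  set a0 := aI D I
  set b0 := bI n D I
  set g := minEl I
  set G := maxEl I
  have ha0 : a0 ∈ Dbar n D := mem_Dbar.2 (a1.elim Or.inl (fun h => Or.inr (Or.inr h)))
  have hb0 : b0 ∈ Dbar n D := mem_Dbar.2 (Or.inr b1)
  have hag := a2 g g1
  have haG := a2 G G1
  have hbg := b2 g g1
  have hbG := b2 G G1
  have hgG := g2 G G1
  have ha0I : a0 ∉ I := fun h => lt_irrefl _ (a2 _ h)
  have hb0I : b0 ∉ I := fun h => lt_irrefl _ (b2 _ h)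
  have hgD : g ∈ Dbar n D ↔ g ∈ D := by
    have := mem_Icc.1 (hsub g1)
    rw [mem_Dbar]
    constructor
    · rintro (h | h | h)
      · omega
      · omega
      · exact h
    · exact fun h => Or.inr (Or.inr h)
  have hGD : G ∈ Dbar n D ↔ G ∈ D := by
    have := mem_Icc.1 (hsub G1)
    rw [mem_Dbar]
    constructor
    · rintro (h | h | h)
      · omega
      · omega
      · exact h
    · exact fun h => Or.inr (Or.inr h)
  -- reduction to four pairs
  have hred : (∑ p ∈ Dbar n D ×ˢ Dbar n D, if p.1 < p.2 then Yab n D U I p.1 p.2 else 0)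
      = ∑ p ∈ ({a0, g} ×ˢ {b0, G} : Finset (ℕ × ℕ)),
        if (p.1 ∈ Dbar n D ∧ p.2 ∈ Dbar n D ∧ p.1 < p.2) then Yab n D U I p.1 p.2 else 0 := by
    have h1 : (∑ p ∈ Dbar n D ×ˢ Dbar n D, if p.1 < p.2 then Yab n D U I p.1 p.2 else 0)
      = ∑ p ∈ Dbar n D ×ˢ Dbar n D,
        if (p.1 ∈ Dbar n D ∧ p.2 ∈ Dbar n D ∧ p.1 < p.2) then Yab n D U I p.1 p.2 else 0 := by
      apply sum_congr rfl
      intro p hp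
      rw [mem_product] at hp
      simp only [hp.1, hp.2, true_and]
    rw [h1]
    apply sum_congr_of_eq_on_inter
    · rintro ⟨a, b⟩ hp hp2
      rw [mem_product] at hp
      simp only [mem_product, mem_insert, mem_singleton] at hp2
      split_ifs with h
      · simp only at h hp ⊢
        apply Yab_zero S hp.1 hp.2 h.2.2
        rintro ⟨c1, c2, c3⟩
        apply hp2
        have ha := mem_Dbar.1 hp.1
        have hb := mem_Dbar.1 hp.2
        have hle : ∀ i ∈ I, a ≤ i ∧ i ≤ b := by grind
        have l1 := hle g g1
        have l2 := hle G G1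
        constructor
        · by_contra hcon
          push Not at hcon
          have k1 : a < g := by omega
          have k2 : a ≤ a0 := by
            rcases ha with h | h | h
            · omega
            · omega
            · exact a3 a h (fun i hi => lt_of_lt_of_le k1 (g2 i hi))
          have k3 : a0 ∈ D := by
            rcases a1 with h | h
            · omega
            · exact h
          exact ha0I (c1 a0 k3 (by omega) (by omega))
        · by_contra hcon
          push Not at hcon
          have k1 : G < b := by omega
          have k2 : b0 ≤ b := by
            rcases hb with h | h | h
            · omega
            · omega
            · exact b3 b h (fun i hi => lt_of_le_of_lt (G2 i hi) k1)
          have k3 : b0 ∈ D := by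
            rcases b1 with h | h
            · have : b ≤ n + 1 := by
                rcases hb with h | h | h
                · omega
                · omega
                · have := hD b h; omega
              omega
            · exact h
          exact hb0I (c1 b0 k3 (by omega) (by omega))
      · rfl
    · rintro ⟨a, b⟩ _ hp2
      rw [mem_product] at hp2
      rw [if_neg (fun h => hp2 ⟨h.1, h.2.1⟩)]
    · intro p _ _
      rfl
  rw [hred, sum_product, sum_pair (by omega), sum_pair (by omega), sum_pair (by omega)]
  simp only [ha0, hb0, hgD, hGD, true_and]
  rw [if_pos (by omega)]
  have hnest' : ∀ d ∈ D, a0 < d → d < b0 → d ∈ I := hnest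
  have C1 : Cond D U I a0 b0 := ⟨hnest', fun d hd _ => ⟨(a2 d hd).le, (b2 d hd).le⟩,
    fun d hd _ => ⟨a2 d hd, b2 d hd⟩⟩
  have C2 : g ∈ D → Cond D U I g b0 := fun h => ⟨fun d hd h1 h2 => hnest' d hd (by omega) h2,
    fun d hd _ => ⟨g2 d hd, (b2 d hd).le⟩,
    fun d hd hdU => ⟨lt_of_le_of_ne (g2 d hd) (fun e => hdis g h (e ▸ hdU)), b2 d hd⟩⟩
  have C3 : G ∈ D → Cond D U I a0 G := fun h => ⟨fun d hd h1 h2 => hnest' d hd h1 (by omega),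
    fun d hd _ => ⟨(a2 d hd).le, G2 d hd⟩,
    fun d hd hdU => ⟨a2 d hd, lt_of_le_of_ne (G2 d hd) (fun e => hdis G h (e ▸ hdU))⟩⟩
  have C4 : g ∈ D → G ∈ D → Cond D U I g G := fun h h' =>
    ⟨fun d hd h1 h2 => hnest' d hd (by omega) (by omega),
    fun d hd _ => ⟨g2 d hd, G2 d hd⟩, fun d hd hdU => ⟨((C2 h).2.2 d hd hdU).1, ((C3 h').2.2 d hd hdU).2⟩⟩
  have sa : sg I a0 = 1 := if_neg ha0I
  have sb : sg I b0 = 1 := if_neg hb0I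
  have sg' : sg I g = -1 := if_pos g1
  have sG' : sg I G = -1 := if_pos G1
  by_cases hS : ∃ i ∈ I, i ∈ U
  · have hSne : (I ∩ U).Nonempty := by
      obtain ⟨i, h1, h2⟩ := hS
      exact ⟨i, mem_inter.2 ⟨h1, h2⟩⟩
    obtain ⟨s1, s2⟩ := minEl_spec hSne
    obtain ⟨t1, t2⟩ := maxEl_spec hSne
    set s := minEl (I ∩ U)
    set t := maxEl (I ∩ U)
    have hmin : ∀ i ∈ I, i ∈ U → s ≤ i ∧ i ≤ t := fun i h1 h2 =>
      ⟨s2 i (mem_inter.2 ⟨h1, h2⟩), t2 i (mem_inter.2 ⟨h1, h2⟩)⟩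
    obtain ⟨sI, sU⟩ := mem_inter.1 s1
    obtain ⟨tI, tU⟩ := mem_inter.1 t1
    have hst := (hmin s sI sU).2
    have Y : ∀ a b, a ∈ Dbar n D → b ∈ Dbar n D → a < b → Cond D U I a b →
        Yab n D U I a b = _ := fun a b ha hb hab hc =>
      Yab_nonempty S hsub ha hb hab hc sI sU tI tU hmin
    have Y1 := Y a0 b0 ha0 hb0 (by omega) C1
    rw [sa, sb] at Y1
    by_cases hg : g ∈ D
    · have hgs := ((C2 hg).2.2 s sI sU)
      have hsing : ¬ ∃ u ∈ U, I = {u} := by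
        rintro ⟨u, hu, hI⟩
        have k1 : g = u := by rw [hI] at g1; exact mem_singleton.1 g1
        exact hdis g hg (k1 ▸ hu)
      rw [if_neg hsing]
      have Y2 := Y g b0 (hgD.2 hg) hb0 (by omega) (C2 hg)
      rw [sg', sb] at Y2
      by_cases hG : G ∈ D
      · have hgG2 : g < G := by
          have := ((C3 hG).2.2 s sI sU)
          omega
        have Y3 := Y a0 G ha0 (hGD.2 hG) (by omega) (C3 hG)
        have Y4 := Y g G (hgD.2 hg) (hGD.2 hG) hgG2 (C4 hg hG)
        rw [sa, sG'] at Y3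
        rw [sg', sG'] at Y4
        rw [if_pos ⟨hG, by omega⟩, if_pos ⟨hg, by omega⟩, if_pos ⟨hg, hG, hgG2⟩, Y1, Y2, Y3, Y4]
        push_cast
        ring
      · have hGt : G = t := by
          apply le_antisymm (hmin G G1 ((hall G G1).resolve_left hG)).2 (G2 t tI)
        rw [if_neg (fun h => hG h.1), if_pos ⟨hg, by omega⟩, if_neg (fun h => hG h.2.1), Y1, Y2, hGt]
        push_cast
        ring
    · have hgs : g = s := by
        apply le_antisymm (g2 s sI) (hmin g g1 ((hall g g1).resolve_left hg)).1
      by_cases hG : G ∈ D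
      · have hsing : ¬ ∃ u ∈ U, I = {u} := by
          rintro ⟨u, hu, hI⟩
          have k1 : G = u := by rw [hI] at G1; exact mem_singleton.1 G1
          exact hdis G hG (k1 ▸ hu)
        have Y3 := Y a0 G ha0 (hGD.2 hG) (by omega) (C3 hG)
        rw [sa, sG'] at Y3
        rw [if_neg hsing, if_pos ⟨hG, by omega⟩, if_neg (fun h => hg h.1), if_neg (fun h => hg h.1), Y1, Y3, hgs]
        push_cast
        ring
      · have hGt : G = t := by
          apply le_antisymm (hmin G G1 ((hall G G1).resolve_left hG)).2 (G2 t tI)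
        have hsing : (∃ u ∈ U, I = {u}) ↔ s = t := by
          constructor
          · rintro ⟨u, hu, hI⟩
            rw [hI, mem_singleton] at sI tI
            omega
          · intro h
            refine ⟨s, sU, ?_⟩
            ext i
            rw [mem_singleton]
            constructor
            · intro hi
              have := g2 i hi
              have := G2 i hi
              omega
            · rintro rfl
              exact sI
        rw [if_neg (fun h => hG h.1), if_neg (fun h => hg h.1), if_neg (fun h => hg h.1), Y1, hgs, hGt]
        simp only [hsing]
        push_cast
        ring
  · have hS' : ∀ i ∈ I, i ∉ U := fun i h1 h2 => hS ⟨i, h1, h2⟩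
    have hIU : I ∩ U = ∅ := by
      ext i; simp only [mem_inter, notMem_empty]; grind
    have hg : g ∈ D := (hall g g1).resolve_right (hS' g g1)
    have hG : G ∈ D := (hall G G1).resolve_right (hS' G G1)
    have hsing : ¬ ∃ u ∈ U, I = {u} := by
      rintro ⟨u, hu, hI⟩
      have k1 : g = u := by rw [hI] at g1; exact mem_singleton.1 g1
      exact hdis g hg (k1 ▸ hu)
    have Y1 := Yab_empty S hsub ha0 hb0 (by omega) C1 hS'
    have Y2 := Yab_empty S hsub (hgD.2 hg) hb0 (by omega) (C2 hg) hS'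
    have Y3 := Yab_empty S hsub ha0 (hGD.2 hG) (by omega) (C3 hG) hS'
    rw [wAs_eq S (by omega), sa, sb] at Y1
    rw [wAs_eq S (by omega), sg', sb] at Y2
    rw [wAs_eq S (by omega), sa, sG'] at Y3
    have Y4 : (if g ∈ D ∧ G ∈ D ∧ g < G then Yab n D U I g G else 0)
        = ((Afun D U g : ℝ) + Bfun D U G) * ((Afun D U g : ℝ) + Bfun D U G + 1) / 2 := by
      split_ifs with h
      · rw [Yab_empty S hsub (hgD.2 hg) (hGD.2 hG) h.2.2 (C4 hg hG) hS', wAs_eq S h.2.2, sg', sG']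
        ring
      · have e : g = G := by
          by_contra hne'
          exact h ⟨hg, hG, by omega⟩
        have k := AB_D S hG
        have k2 : ((Afun D U G : ℝ) + Bfun D U G) = -1 := by exact_mod_cast k
        rw [e, k2]
        norm_num
    rw [Y4, if_pos ⟨hG, by omega⟩, if_pos ⟨hg, by omega⟩, Y1, Y2, Y3, if_neg hsing, hIU]
    push_cast
    simp only [card_empty, pow_zero]
    ring

/-- for the associahedron right-hand sides, if `I` is nested and not a
one-element subset of `U` then `y_I = (−1)^{|I∩U|} K_γ K_Γ`; if `I = {u}` with `u ∈ U`
then `y_I = (−1)^{|I∩U|}(K_γ K_Γ − (n+1)) = −(K_γ K_Γ − (n+1))`; if `v(I) ≥ 2` then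
`y_I = 0`. -/
theorem statement2 (n : ℕ) (D U : Finset ℕ) (hn : 2 ≤ n)
    (hDU : D ∪ U = Finset.Icc 1 n) (hdisj : Disjoint D U) (h1D : 1 ∈ D) (hnD : n ∈ D)
    (I : Finset ℕ) (hne : I.Nonempty) (hsub : I ⊆ Finset.Icc 1 n) :
    (IsNested n D I → (¬ ∃ u ∈ U, I = {u}) →
        yI n D U (wAs n D U) (znAs n) I =
          (-1 : ℝ) ^ (I ∩ U).card * ((Kgam n D U I * KGam n D U I : ℤ) : ℝ))
    ∧ (∀ u ∈ U, I = {u} →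
        yI n D U (wAs n D U) (znAs n) I =
            (-1 : ℝ) ^ (I ∩ U).card *
              ((Kgam n D U I * KGam n D U I - ((n : ℤ) + 1) : ℤ) : ℝ)
          ∧ yI n D U (wAs n D U) (znAs n) I =
            -(((Kgam n D U I * KGam n D U I - ((n : ℤ) + 1) : ℤ) : ℝ)))
    ∧ (2 ≤ vI n D I → yI n D U (wAs n D U) (znAs n) I = 0) := by
  have S : Setup n D U := by
    have hm : ∀ i, i ∈ D ∨ i ∈ U ↔ 1 ≤ i ∧ i ≤ n := by
      intro i
      rw [← mem_union, hDU, mem_Icc]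
    exact ⟨fun d hd => (hm d).1 (Or.inl hd), fun u hu => (hm u).1 (Or.inr hu),
      fun d hd => Finset.disjoint_left.1 hdisj hd, fun i h1 h2 => (hm i).2 ⟨h1, h2⟩, h1D, hnD⟩
  refine ⟨?_, ?_, ?_⟩
  · intro hN hs
    rw [yI_nested S hN, if_neg hs]
    push_cast
    ring
  · intro u hu hI
    have hN : IsNested n D I := hI ▸ singleton_nested_s2 S hu
    have hc : (I ∩ U).card = 1 := by
      rw [hI, singleton_inter_of_mem hu, card_singleton]
    rw [yI_nested S hN, if_pos ⟨u, hu, hI⟩, hc]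
    push_cast
    constructor <;> ring
  · intro hv
    exact yI_nonnested S hne hsub (nested_of_vI hv)

end AssocPaper
end
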